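/- arXiv:1112.2916 — 2 statements merged into one kernel-verified Lean document; each statement's English description precedes it below -/
import Mathlib

section
/- Let L be a differential field extension of ℂ(t) with derivation D, let K be a differential subfield of L, and let y ∈ L be a solution of the first Painlevé equation y'' = 6y² + t. Then either y is algebraic over K, or the two elements y and y' are algebraically independent over K. (Strong minimality of P_I; Fact 3.2, which is the strong minimality part of Proposition 3.1.) -/
open Polynomial

/-- The derivation of `A[X]` that applies a derivation of `A` to the coefficients. -/
noncomputable def Derivation.coeffwise {k A : Type*} [CommRing k] [CommRing A] [Algebra k A]
    (d : Derivation k A A) : Derivation k A[X] A[X] :=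
  PolynomialModule.equivPolynomialSelf.compDer d.mapCoeffs

theorem Derivation.coeff_coeffwise {k A : Type*} [CommRing k] [CommRing A] [Algebra k A]
    (d : Derivation k A A) (p : A[X]) (i : ℕ) : (d.coeffwise p).coeff i = d (p.coeff i) := rfl

theorem Derivation.coeffwise_C {k A : Type*} [CommRing k] [CommRing A] [Algebra k A]
    (d : Derivation k A A) (a : A) : d.coeffwise (C a) = C (d a) := by
  ext i
  rw [d.coeff_coeffwise, coeff_C, coeff_C]
  split_ifs <;> simp

theorem Derivation.coeffwise_X {k A : Type*} [CommRing k] [CommRing A] [Algebra k A]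
    (d : Derivation k A A) : d.coeffwise (X : A[X]) = 0 := by
  ext i
  rw [d.coeff_coeffwise, coeff_X]
  split_ifs <;> simp

namespace PainleveI

/-- The usual derivative of polynomials, as a derivation over a ring of constants. -/
noncomputable def derivativeOver (k A : Type*) [CommRing k] [CommRing A] [Algebra k A] :
    Derivation k A[X] A[X] :=
  (derivative' (R := A)).restrictScalars k

theorem derivativeOver_apply (k : Type*) {A : Type*} [CommRing k] [CommRing A] [Algebra k A]
    (p : A[X]) : derivativeOver k A p = derivative p := rfl

section Coefficients

variable {K : Type*} [Field K]

theorem eq_zero_of_recurrence [CharZero K] {q : ℤ → ℤ → K} (hq : ∀ i j, j < 0 → q i j = 0)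
    {w J : ℤ}
    (h : ∀ i j, 2 * i + 6 * j = w → j ≤ J →
      (4 * i - 2) * q (i - 2) j + (i + 1) * q (i + 1) (j - 1) = 0)
    (i j : ℤ) (hw : 2 * i + 6 * j + 4 = w) (hj : j ≤ J) : q i j = 0 := by
  have key : ∀ n : ℕ, ∀ i : ℤ, 2 * i + 6 * ((n : ℤ) - 1) + 4 = w → (n : ℤ) - 1 ≤ J →
      q i ((n : ℤ) - 1) = 0 := by
    intro n
    induction n with
    | zero => intro i _ _; exact hq _ _ (by simp)
    | succ n ih =>
      intro i hi hJ
      have h1 := h (i + 2) ((n + 1 : ℕ) - 1) (by omega) hJ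
      have h2 := ih (i + 3) (by push_cast at hi; omega) (by push_cast at hJ; omega)
      rw [show i + 2 - 2 = i by ring, show i + 2 + 1 = i + 3 by ring,
        show ((n + 1 : ℕ) : ℤ) - 1 - 1 = (n : ℤ) - 1 by push_cast; ring, h2, mul_zero,
        add_zero] at h1
      refine (mul_eq_zero.mp h1).resolve_left fun h0 => ?_
      have h3 : ((4 * (i + 2) - 2 : ℤ) : K) = 0 := by exact_mod_cast h0
      have := Int.cast_eq_zero.mp h3
      omega
  rcases lt_or_ge j 0 with h0 | h0
  · exact hq i j h0
  · have := key (j + 1).toNat i (by omega) (by omega)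
    rwa [show (((j + 1).toNat : ℕ) : ℤ) - 1 = j by omega] at this

/-- `p i j` (of weight `2 i + 6 j`) and `q i j` (of weight `2 i + 6 j + 3`) vanish in weights
above `n`. -/
def VanishAbove (p q : ℤ → ℤ → K) (n : ℤ) : Prop :=
  (∀ i j, n < 2 * i + 6 * j → p i j = 0) ∧ ∀ i j, n < 2 * i + 6 * j + 3 → q i j = 0

variable {d : Derivation ℤ K K} {t : K} {p q r s : ℤ → ℤ → K}

theorem VanishAbove.pred_of_shift {e : ℤ} (he : 1 ≤ e) {b : K} (hb : b ≠ 0)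
    (hF : ∀ i j, d (p i j) - 2 * (j + 1) * p (i - 1) (j + 1) + (4 * i - 2) * q (i - 2) j
      + (2 * i + 1) * t * q i j + (i + 1) * q (i + 1) (j - 1) = r i j)
    (hG : ∀ i j, (i + 1) * p (i + 1) j + d (q i j) - 2 * (j + 1) * q (i - 1) (j + 1) = s i j)
    (hr : ∀ i j, (∀ i', i < i' → p i' j = 0) → r (i + e) j = b * p i j)
    (hs : ∀ i j, (∀ i', i < i' → q i' j = 0) → s (i + e) j = b * q i j)
    {n : ℤ} (h : VanishAbove p q n) : VanishAbove p q (n - 1) := by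
  obtain ⟨hp, hq⟩ := h
  constructor
  · intro i j hij
    have h1 := hF (i + e) j
    rw [hr i j fun i' hi' => hp _ _ (by omega), hp _ _ (by omega), hp _ _ (by omega),
      hq _ _ (by omega), hq _ _ (by omega), hq _ _ (by omega)] at h1
    simpa [hb] using h1.symm
  · intro i j hij
    have h1 := hG (i + e) j
    rw [hs i j fun i' hi' => hq _ _ (by omega), hp _ _ (by omega), hq _ _ (by omega),
      hq _ _ (by omega)] at h1
    simpa [hb] using h1.symm

theorem VanishAbove.pred [CharZero K] {a : K}
    (hqi : ∀ i j, i < 0 → q i j = 0) (hqj : ∀ i j, j < 0 → q i j = 0)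
    (hF : ∀ i j, d (p i j) - 2 * (j + 1) * p (i - 1) (j + 1) + (4 * i - 2) * q (i - 2) j
      + (2 * i + 1) * t * q i j + (i + 1) * q (i + 1) (j - 1) = a * p i j)
    (hG : ∀ i j, (i + 1) * p (i + 1) j + d (q i j) - 2 * (j + 1) * q (i - 1) (j + 1)
      = a * q i j)
    {n : ℤ} (hn : 1 ≤ n) (h : VanishAbove p q n) : VanishAbove p q (n - 1) := by
  obtain ⟨hp, hq⟩ := h
  have hG' : ∀ i j, i ≠ 0 → q (i - 1) j = 0 → q (i - 2) (j + 1) = 0 → p i j = 0 := by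
    intro i j hi h1 h2
    have h3 := hG (i - 1) j
    rw [show i - 1 - 1 = i - 2 by ring, sub_add_cancel, h1, h2] at h3
    have h4 : (i : K) ≠ 0 := Int.cast_ne_zero.mpr hi
    simpa [h4] using h3
  have hq' : ∀ i j, n - 1 < 2 * i + 6 * j + 3 → q i j = 0 := by
    intro i j hij
    refine eq_zero_of_recurrence hqj (w := 2 * i + 6 * j + 4) (J := j) ?_ i j rfl le_rfl
    intro i' j' hw _
    have h1 := hF i' j'
    rw [hp _ _ (by omega), hp _ _ (by omega), hq i' j' (by omega)] at h1
    simpa using h1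
  refine ⟨fun i j hij => ?_, hq'⟩
  have hp' : ∀ i j, i ≠ 0 → n - 1 < 2 * i + 6 * j → p i j = 0 := fun i j hi hw =>
    hG' i j hi (hq _ _ (by omega)) (hq _ _ (by omega))
  by_cases hi : i ≠ 0
  · exact hp' i j hi hij
  push Not at hi
  subst hi
  by_cases hnj : n < 6 * j
  · exact hp _ _ (by omega)
  have q1 : ∀ i' j', 2 * i' + 6 * j' + 3 = n - 1 → q i' j' = 0 := by
    intro i' j' hw
    by_cases hi' : i' < 0
    · exact hqi _ _ hi'
    refine eq_zero_of_recurrence hqj (w := n) (J := j - 1) ?_ i' j' (by omega) (by omega)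
    intro k l hw hl
    have h1 := hF k l
    rw [hp' _ _ (by omega) (by omega), hp _ _ (by omega), hq k l (by omega)] at h1
    simpa using h1
  have p2 : ∀ i' j', 2 * i' + 6 * j' = n - 2 → p i' j' = 0 := fun i' j' hw =>
    hG' _ _ (by omega) (q1 _ _ (by omega)) (hq _ _ (by omega))
  have q3 : ∀ i' j', 2 * i' + 6 * j' + 3 = n - 3 → q i' j' = 0 := by
    intro i' j' hw
    refine eq_zero_of_recurrence hqj (w := n - 2) (J := j') ?_ i' j' (by omega) le_rfl
    intro k l hw hl
    have h1 := hF k l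
    rw [p2 _ _ (by omega), hp _ _ (by omega), hq k l (by omega)] at h1
    simpa using h1
  have p4 : ∀ i' j', 2 * i' + 6 * j' = n - 4 → p i' j' = 0 := fun i' j' hw =>
    hG' _ _ (by omega) (q3 _ _ (by omega)) (hq _ _ (by omega))
  have q5 : q 2 (j - 2) = 0 := by
    refine eq_zero_of_recurrence hqj (w := n - 4) (J := j - 2) ?_ _ _ (by omega) le_rfl
    intro k l hw hl
    have h1 := hF k l
    rw [p4 _ _ (by omega), hp' _ _ (by omega) (by omega), q1 k l (by omega)] at h1
    simpa using h1
  have h1 := hF 1 (j - 1)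
  rw [p4 _ _ (by omega), hqi (1 - 2) _ (by omega), q1 _ _ (by omega),
    show (1 : ℤ) + 1 = 2 by ring, show j - 1 - 1 = j - 2 by ring, q5, sub_add_cancel,
    sub_self] at h1
  have hj : (j : K) ≠ 0 := Int.cast_ne_zero.mpr (by omega)
  simpa [hj] using h1

/-- The coefficient of `X ^ i` in the coefficient of `X ^ j`, extended by zero to all integers. -/
noncomputable def intCoeff (P : K[X][X]) (i j : ℤ) : K :=
  if 0 ≤ i ∧ 0 ≤ j then (P.coeff j.toNat).coeff i.toNat else 0

theorem intCoeff_natCast (P : K[X][X]) (i j : ℕ) : intCoeff P i j = (P.coeff j).coeff i := by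
  simp [intCoeff]

theorem intCoeff_neg_left (P : K[X][X]) (i j : ℤ) (hi : i < 0) : intCoeff P i j = 0 :=
  if_neg (by omega)

theorem intCoeff_neg_right (P : K[X][X]) (i j : ℤ) (hj : j < 0) : intCoeff P i j = 0 :=
  if_neg (by omega)

theorem intCoeff_add (P Q : K[X][X]) (i j : ℤ) :
    intCoeff (P + Q) i j = intCoeff P i j + intCoeff Q i j := by
  unfold intCoeff; split_ifs <;> simp

theorem intCoeff_sub (P Q : K[X][X]) (i j : ℤ) :
    intCoeff (P - Q) i j = intCoeff P i j - intCoeff Q i j := by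
  unfold intCoeff; split_ifs <;> simp

theorem intCoeff_C_C_mul (a : K) (P : K[X][X]) (i j : ℤ) :
    intCoeff (C (C a) * P) i j = a * intCoeff P i j := by
  unfold intCoeff; split_ifs <;> simp

theorem intCoeff_X_mul (P : K[X][X]) (i j : ℤ) :
    intCoeff (X * P) i j = intCoeff P i (j - 1) := by
  rcases lt_or_ge i 0 with hi | hi
  · rw [intCoeff_neg_left _ _ _ hi, intCoeff_neg_left _ _ _ hi]
  rcases lt_or_ge j 0 with hj | hj
  · rw [intCoeff_neg_right _ _ _ hj, intCoeff_neg_right _ _ _ (by omega)]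
  lift i to ℕ using hi
  lift j to ℕ using hj
  cases j with
  | zero => rw [intCoeff_natCast, intCoeff_neg_right _ _ _ (by simp)]; simp
  | succ j =>
    rw [show ((j + 1 : ℕ) : ℤ) - 1 = j by push_cast; ring, intCoeff_natCast, intCoeff_natCast,
      coeff_X_mul]

theorem intCoeff_C_X_mul (P : K[X][X]) (i j : ℤ) :
    intCoeff (C X * P) i j = intCoeff P (i - 1) j := by
  rcases lt_or_ge j 0 with hj | hj
  · rw [intCoeff_neg_right _ _ _ hj, intCoeff_neg_right _ _ _ hj]
  rcases lt_or_ge i 0 with hi | hi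
  · rw [intCoeff_neg_left _ _ _ hi, intCoeff_neg_left _ _ _ (by omega)]
  lift i to ℕ using hi
  lift j to ℕ using hj
  cases i with
  | zero => rw [intCoeff_natCast, intCoeff_neg_left _ _ _ (by simp)]; simp
  | succ i =>
    rw [show ((i + 1 : ℕ) : ℤ) - 1 = i by push_cast; ring, intCoeff_natCast, intCoeff_natCast,
      coeff_C_mul, coeff_X_mul]

theorem intCoeff_derivative (P : K[X][X]) (i j : ℤ) :
    intCoeff (derivative P) i j = (j + 1) * intCoeff P i (j + 1) := by
  rcases lt_or_ge i 0 with hi | hi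
  · rw [intCoeff_neg_left _ _ _ hi, intCoeff_neg_left _ _ _ hi, mul_zero]
  rcases lt_or_ge j 0 with hj | hj
  · rw [intCoeff_neg_right _ _ _ hj]
    rcases lt_or_ge (j + 1) 0 with hj' | hj'
    · rw [intCoeff_neg_right _ _ _ hj', mul_zero]
    · obtain rfl : j = -1 := by omega
      simp
  lift i to ℕ using hi
  lift j to ℕ using hj
  rw [show (j : ℤ) + 1 = ((j + 1 : ℕ) : ℤ) by push_cast; ring, intCoeff_natCast,
    intCoeff_natCast, coeff_derivative, mul_comm,
    show ((j : K[X]) + 1) = ((j + 1 : ℕ) : K[X]) by push_cast; ring, coeff_natCast_mul]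
  push_cast
  ring

theorem intCoeff_coeffwise_derivative (P : K[X][X]) (i j : ℤ) :
    intCoeff ((derivativeOver ℤ K).coeffwise P) i j = (i + 1) * intCoeff P (i + 1) j := by
  rcases lt_or_ge j 0 with hj | hj
  · rw [intCoeff_neg_right _ _ _ hj, intCoeff_neg_right _ _ _ hj, mul_zero]
  rcases lt_or_ge i 0 with hi | hi
  · rw [intCoeff_neg_left _ _ _ hi]
    rcases lt_or_ge (i + 1) 0 with hi' | hi'
    · rw [intCoeff_neg_left _ _ _ hi', mul_zero]
    · obtain rfl : i = -1 := by omega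
      simp
  lift i to ℕ using hi
  lift j to ℕ using hj
  rw [show (i : ℤ) + 1 = ((i + 1 : ℕ) : ℤ) by push_cast; ring, intCoeff_natCast,
    intCoeff_natCast, Derivation.coeff_coeffwise, derivativeOver_apply, coeff_derivative, mul_comm]
  push_cast
  ring

theorem intCoeff_coeffwise_coeffwise (P : K[X][X]) (i j : ℤ) :
    intCoeff (d.coeffwise.coeffwise P) i j = d (intCoeff P i j) := by
  unfold intCoeff
  split_ifs
  · rfl
  · simp

theorem intCoeff_C_mul_natDegree (A : K[X]) (P : K[X][X]) (i j : ℤ)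
    (h : ∀ i', i < i' → intCoeff P i' j = 0) :
    intCoeff (C A * P) (i + A.natDegree) j = A.leadingCoeff * intCoeff P i j := by
  rcases lt_or_ge j 0 with hj | hj
  · rw [intCoeff_neg_right _ _ _ hj, intCoeff_neg_right _ _ _ hj, mul_zero]
  lift j to ℕ using hj
  rcases lt_or_ge i 0 with hi | hi
  · rw [intCoeff_neg_left _ _ _ hi, mul_zero]
    have h0 : P.coeff j = 0 := by
      ext k
      rw [← intCoeff_natCast, h _ (by omega), coeff_zero]
    unfold intCoeff
    simp [h0]
  lift i to ℕ using hi
  have hdeg : (P.coeff j).natDegree ≤ i := by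
    rw [natDegree_le_iff_coeff_eq_zero]
    intro k hk
    rw [← intCoeff_natCast, h _ (by exact_mod_cast hk)]
  rw [← Nat.cast_add, intCoeff_natCast, intCoeff_natCast, coeff_C_mul, add_comm,
    coeff_mul_add_eq_of_natDegree_le le_rfl hdeg, coeff_natDegree]

theorem exists_vanishAbove (f g : K[X][X]) :
    ∃ n : ℕ, VanishAbove (intCoeff f) (intCoeff g) n := by
  have key : ∀ P : K[X][X], ∃ n : ℕ, ∀ i j : ℤ, (n : ℤ) < 2 * i + 6 * j → intCoeff P i j = 0 := by
    intro P
    refine ⟨∑ j ∈ Finset.range (P.natDegree + 1), 2 * (P.coeff j).natDegree + 6 * P.natDegree,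
      fun i j hij => ?_⟩
    rcases lt_or_ge j 0 with hj | hj
    · exact intCoeff_neg_right _ _ _ hj
    rcases lt_or_ge i 0 with hi | hi
    · exact intCoeff_neg_left _ _ _ hi
    lift i to ℕ using hi
    lift j to ℕ using hj
    rw [intCoeff_natCast]
    by_cases hjn : P.natDegree < j
    · rw [coeff_eq_zero_of_natDegree_lt hjn, coeff_zero]
    · have h1 := Finset.single_le_sum (f := fun j => 2 * (P.coeff j).natDegree)
        (fun _ _ => Nat.zero_le _) (Finset.mem_range.mpr (show j < P.natDegree + 1 by omega))
      apply coeff_eq_zero_of_natDegree_lt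
      omega
  obtain ⟨m, hm⟩ := key f
  obtain ⟨n, hn⟩ := key g
  exact ⟨m + n + 3, fun i j h => hm i j (by push_cast at h; omega),
    fun i j h => hn i j (by push_cast at h; omega)⟩

end Coefficients

section Derivation

variable {K : Type*} [Field K] (d : Derivation ℤ K K) (t : K)

/-- The derivation of `K[Y][Z]` (with `Y = C X` and `Z = X`) extending `d` such that
`Y' = Z` and `Z' = 6 Y ^ 2 + t`. -/
noncomputable def der : Derivation ℤ K[X][X] K[X][X] :=
  d.coeffwise.coeffwise + (X : K[X][X]) • (derivativeOver ℤ K).coeffwise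
    + (C (6 * X ^ 2 + C t) : K[X][X]) • derivativeOver ℤ K[X]

theorem der_apply (P : K[X][X]) :
    der d t P = d.coeffwise.coeffwise P + X * (derivativeOver ℤ K).coeffwise P
      + C (6 * X ^ 2 + C t) * derivative P := rfl

theorem der_C_C (a : K) : der d t (C (C a)) = C (C (d a)) := by
  simp [der_apply, Derivation.coeffwise_C, derivativeOver_apply]

theorem der_C_X : der d t (C X) = X := by
  simp [der_apply, Derivation.coeffwise_C, Derivation.coeffwise_X, derivativeOver_apply]

theorem der_X : der d t X = C (6 * X ^ 2 + C t) := by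
  simp [der_apply, Derivation.coeffwise_X]

theorem der_C (a : K[X]) :
    der d t (C a) = C (d.coeffwise a) + X * C (derivative a) := by
  simp [der_apply, Derivation.coeffwise_C, derivativeOver_apply]

/-- The energy `Z ^ 2 - 4 Y ^ 3 - 2 t Y`, whose derivative is `-2 Y` when `t' = 1`. -/
noncomputable def energy : K[X][X] := X ^ 2 - C (4 * X ^ 3 + 2 * C t * X)

theorem natDegree_energy : (energy t).natDegree = 2 := by
  unfold energy
  rw [natDegree_sub_C, natDegree_X_pow]

theorem der_energy (ht : d t = 1) : der d t (energy t) = -2 * C X := by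
  have h : energy t = X ^ 2 - (4 * C X ^ 3 + 2 * C (C t) * C X) := by
    simp only [energy, map_add, map_mul, map_pow, map_ofNat]
  have h2 : der d t 2 = 0 := by simpa using (der d t).map_natCast 2
  have h4 : der d t 4 = 0 := by simpa using (der d t).map_natCast 4
  rw [h]
  simp only [map_sub, map_add, Derivation.leibniz, Derivation.leibniz_pow, der_X, der_C_X,
    der_C_C, h2, h4, ht, smul_eq_mul, nsmul_eq_mul, map_one, map_mul, map_pow, map_ofNat]
  push_cast
  ring

theorem der_comp_energy (ht : d t = 1) (f : K[X][X]) :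
    der d t (f.comp (energy t)) =
      (d.coeffwise.coeffwise f - 2 * (C X * derivative f)).comp (energy t)
        + X * ((derivativeOver ℤ K).coeffwise f).comp (energy t) := by
  induction f using Polynomial.induction_on' with
  | add p q hp hq =>
    simp only [add_comp, map_add, hp, hq, sub_comp, mul_comp]
    ring
  | monomial n a =>
    have hd : ∀ D : Derivation ℤ K[X] K[X],
        D.coeffwise (monomial n a) = monomial n (D a) := by
      intro D
      ext1 i
      rw [D.coeff_coeffwise, coeff_monomial, coeff_monomial]
      split_ifs <;> simp
    rw [hd, hd, derivative_monomial, derivativeOver_apply]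
    simp only [sub_comp, mul_comp, monomial_comp, C_comp, Derivation.leibniz,
      Derivation.leibniz_pow, der_energy d t ht, der_C, smul_eq_mul, nsmul_eq_mul, map_mul,
      map_natCast, ofNat_comp]
    ring

theorem exists_eq_comp_energy (P : K[X][X]) :
    ∃ f g : K[X][X], P = f.comp (energy t) + X * g.comp (energy t) := by
  induction P using Polynomial.induction_on with
  | C a => exact ⟨C a, 0, by simp⟩
  | add p q hp hq =>
    obtain ⟨f, g, rfl⟩ := hp
    obtain ⟨f', g', rfl⟩ := hq
    exact ⟨f + f', g + g', by simp only [add_comp]; ring⟩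
  | monomial n a h =>
    obtain ⟨f, g, h⟩ := h
    refine ⟨(X + C (4 * X ^ 3 + 2 * C t * X)) * g, f, ?_⟩
    rw [pow_succ, ← mul_assoc, h]
    simp only [mul_comp, add_comp, X_comp, C_comp]
    unfold energy
    ring

theorem eq_zero_of_comp_energy {f g : K[X][X]}
    (h : f.comp (energy t) + X * g.comp (energy t) = 0) : f = 0 ∧ g = 0 := by
  have hE := natDegree_energy t
  have hinj : ∀ {u : K[X][X]}, u.comp (energy t) = 0 → u = 0 := by
    intro u hu
    rcases comp_eq_zero_iff.mp hu with h0 | ⟨-, h0⟩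
    · exact h0
    · rw [h0, natDegree_C] at hE
      omega
  have hg : g = 0 := by
    by_contra hg
    have hg' : g.comp (energy t) ≠ 0 := fun h0 => hg (hinj h0)
    have h1 := congrArg natDegree (eq_neg_of_add_eq_zero_left h)
    rw [natDegree_neg, natDegree_X_mul hg', natDegree_comp, natDegree_comp, hE] at h1
    omega
  subst hg
  exact ⟨hinj (by simpa using h), rfl⟩

theorem natDegree_eq_zero_of_der_eq_C_mul [CharZero K] (ht : d t = 1) {P : K[X][X]} {A : K[X]}
    (h : der d t P = C A * P) : P.natDegree = 0 := by
  obtain ⟨f, g, rfl⟩ := exists_eq_comp_energy t P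
  obtain ⟨h1, h2⟩ := eq_zero_of_comp_energy t
    (f := d.coeffwise.coeffwise f - 2 * (C X * derivative f) + C (6 * X ^ 2 + C t) * g
      + (X + C (4 * X ^ 3 + 2 * C t * X)) * (derivativeOver ℤ K).coeffwise g - C A * f)
    (g := (derivativeOver ℤ K).coeffwise f + d.coeffwise.coeffwise g
      - 2 * (C X * derivative g) - C A * g) (by
    rw [map_add, Derivation.leibniz, der_comp_energy d t ht, der_comp_energy d t ht, der_X,
      ← sub_eq_zero] at h
    rw [← h]
    simp only [mul_comp, add_comp, sub_comp, X_comp, C_comp, smul_eq_mul, ofNat_comp]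
    unfold energy
    ring)
  have hF : ∀ i j : ℤ, d (intCoeff f i j) - 2 * (j + 1) * intCoeff f (i - 1) (j + 1)
      + (4 * i - 2) * intCoeff g (i - 2) j + (2 * i + 1) * t * intCoeff g i j
      + (i + 1) * intCoeff g (i + 1) (j - 1) = intCoeff (C A * f) i j := by
    intro i j
    have e : d.coeffwise.coeffwise f - C (C 2) * (C X * derivative f)
        + (C (C 6) * (C X * (C X * g)) + C (C t) * g)
        + (X * (derivativeOver ℤ K).coeffwise g
          + (C (C 4) * (C X * (C X * (C X * (derivativeOver ℤ K).coeffwise g)))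
            + C (C 2) * (C (C t) * (C X * (derivativeOver ℤ K).coeffwise g)))) = C A * f := by
      rw [← sub_eq_zero, ← h1]
      simp only [map_add, map_mul, map_pow, map_ofNat]
      ring
    rw [← e]
    simp only [intCoeff_add, intCoeff_sub, intCoeff_C_C_mul, intCoeff_C_X_mul, intCoeff_X_mul,
      intCoeff_derivative, intCoeff_coeffwise_derivative, intCoeff_coeffwise_coeffwise,
      show i - 1 - 1 = i - 2 by ring, show i - 2 - 1 + 1 = i - 2 by ring,
      show i - 1 + 1 = i by ring]
    push_cast
    ring
  have hG : ∀ i j : ℤ, (i + 1) * intCoeff f (i + 1) j + d (intCoeff g i j)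
      - 2 * (j + 1) * intCoeff g (i - 1) (j + 1) = intCoeff (C A * g) i j := by
    intro i j
    have e : (derivativeOver ℤ K).coeffwise f + d.coeffwise.coeffwise g
        - C (C 2) * (C X * derivative g) = C A * g := by
      rw [← sub_eq_zero, ← h2]
      simp only [map_ofNat]
    rw [← e]
    simp only [intCoeff_add, intCoeff_sub, intCoeff_C_C_mul, intCoeff_C_X_mul,
      intCoeff_derivative, intCoeff_coeffwise_derivative, intCoeff_coeffwise_coeffwise]
    ring
  have hB : VanishAbove (intCoeff f) (intCoeff g) 0 := by
    obtain ⟨n, hn⟩ := exists_vanishAbove f g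
    induction n with
    | zero => simpa using hn
    | succ n ih =>
      refine ih ?_
      rw [show (n : ℤ) = (n + 1 : ℕ) - 1 by push_cast; ring]
      rcases Nat.eq_zero_or_pos A.natDegree with hA | hA
      · rw [natDegree_eq_zero] at hA
        obtain ⟨a, rfl⟩ := hA
        exact hn.pred (intCoeff_neg_left g) (intCoeff_neg_right g)
          (fun i j => by rw [hF, intCoeff_C_C_mul])
          (fun i j => by rw [hG, intCoeff_C_C_mul]) (by omega)
      · exact hn.pred_of_shift (e := A.natDegree) (by omega)
          (leadingCoeff_ne_zero.mpr fun h0 => by simp [h0] at hA) hF hG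
          (intCoeff_C_mul_natDegree A f) (intCoeff_C_mul_natDegree A g)
  have hg : g = 0 := by
    ext j i
    rw [← intCoeff_natCast, hB.2 _ _ (by omega)]
    simp
  have hf : f.natDegree ≤ 0 := by
    rw [natDegree_le_iff_coeff_eq_zero]
    intro j hj
    ext i
    rw [← intCoeff_natCast, hB.1 _ _ (by omega), coeff_zero]
  rw [hg, zero_comp, mul_zero, add_zero, natDegree_comp, Nat.le_zero.mp hf, zero_mul]

theorem natDegree_eq_zero_of_dvd_der [CharZero K] (ht : d t = 1) {P : K[X][X]}
    (h : P ∣ der d t P) : P.natDegree = 0 := by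
  obtain ⟨A, hA⟩ := h
  by_cases hP : P = 0
  · simp [hP]
  have hcoeff : ∀ m, P.natDegree ≤ m →
      (der d t P).coeff (m + 1) = derivative (P.coeff m) := by
    intro m hm
    rw [der_apply, coeff_add, coeff_add, coeff_X_mul, coeff_C_mul, Derivation.coeff_coeffwise,
      Derivation.coeff_coeffwise, coeff_derivative, derivativeOver_apply,
      coeff_eq_zero_of_natDegree_lt (n := m + 1) (by omega),
      coeff_eq_zero_of_natDegree_lt (n := m + 1 + 1) (by omega)]
    simp
  have hlc := leadingCoeff_ne_zero.mpr hP
  suffices hA0 : A.natDegree = 0 by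
    obtain ⟨a, rfl⟩ := natDegree_eq_zero.mp hA0
    exact natDegree_eq_zero_of_der_eq_C_mul d t ht (hA.trans (mul_comm _ _))
  by_contra hA0
  obtain ⟨m, hm⟩ := Nat.exists_eq_add_one_of_ne_zero hA0
  have h1 := hcoeff (P.natDegree + m) (by omega)
  rw [hA, add_assoc, ← hm, coeff_mul_degree_add_degree] at h1
  have hA1 : A.leadingCoeff ≠ 0 := leadingCoeff_ne_zero.mpr fun h0 => by simp [h0] at hA0
  rcases Nat.eq_zero_or_pos m with rfl | hm0
  · have h2 := degree_derivative_lt hlc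
    rw [add_zero, coeff_natDegree] at h1
    rw [← h1, mul_comm] at h2
    exact absurd h2 (not_lt.mpr (degree_le_mul_left _ hA1 |>.trans_eq (by rw [mul_comm])))
  · rw [coeff_eq_zero_of_natDegree_lt (n := P.natDegree + m) (by omega), derivative_zero] at h1
    exact mul_ne_zero hlc hA1 h1

end Derivation

theorem dvd_of_aevalAeval_eq_zero {K L : Type*} [Field K] [Field L] [Algebra K L] {y z : L}
    (hy : Transcendental K y) {P : K[X][X]} (hP : Irreducible P) (hPyz : aevalAeval y z P = 0) :
    0 < P.natDegree ∧ ∀ Q : K[X][X], aevalAeval y z Q = 0 → P ∣ Q := by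
  have hinj : Function.Injective (aeval (R := K) y) := transcendental_iff_injective.mp hy
  have hpos : 0 < P.natDegree := by
    by_contra h0
    obtain ⟨a, rfl⟩ := natDegree_eq_zero.mp (Nat.eq_zero_of_not_pos h0)
    rw [aevalAeval_C] at hPyz
    rw [hinj (hPyz.trans (map_zero _).symm), C_0] at hP
    exact not_irreducible_zero hP
  refine ⟨hpos, fun Q hQ => ?_⟩
  have hprim : P.IsPrimitive := hP.isPrimitive hpos.ne'
  let F := FractionRing K[X]
  let φ : F →+* L := IsFractionRing.lift (A := K[X]) (g := (aeval (R := K) y).toRingHom) hinj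
  have hφ : ∀ R : K[X][X], eval₂ φ z (R.map (algebraMap K[X] F)) = aevalAeval y z R := by
    intro R
    have hc : φ.comp (algebraMap K[X] F) = (aeval (R := K) y).toRingHom := by
      refine RingHom.ext fun x => ?_
      simp [φ]
    have hR : eval₂RingHom (aeval (R := K) y).toRingHom z = (aevalAeval y z).toRingHom := by
      ext <;> simp
    rw [eval₂_map, hc]
    exact DFunLike.congr_fun hR R
  have hirr := (hprim.irreducible_iff_irreducible_map_fraction_map (K := F)).mp hP
  by_contra hndvd
  have hcop : IsCoprime (P.map (algebraMap K[X] F)) (Q.map (algebraMap K[X] F)) := by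
    rw [hirr.coprime_iff_not_dvd]
    exact fun hd => hndvd (hprim.dvd_of_fraction_map_dvd_fraction_map hd)
  obtain ⟨a, b, hab⟩ := hcop
  have := congrArg (eval₂ φ z) hab
  rw [eval₂_add, eval₂_mul, eval₂_mul, hφ, hφ, hPyz, hQ] at this
  simp at this

theorem isAlgebraic_or_algebraicIndependent {K L : Type*} [Field K] [CharZero K] [Field L]
    [Algebra K L] (d : Derivation ℤ K K) (D : Derivation ℤ L L)
    (hdD : ∀ a, D (algebraMap K L a) = algebraMap K L (d a)) {t : K} (ht : d t = 1) {y : L}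
    (hy : D (D y) = 6 * y ^ 2 + algebraMap K L t) :
    IsAlgebraic K y ∨ AlgebraicIndependent K ![y, D y] := by
  by_contra! hcon
  obtain ⟨halg, hind⟩ := hcon
  have hD : ∀ P : K[X][X], aevalAeval y (D y) (der d t P) = D (aevalAeval y (D y) P) := by
    intro P
    induction P using Polynomial.induction_on' with
    | add p q hp hq => simp only [map_add, hp, hq]
    | monomial n a =>
      have hC : aevalAeval y (D y) (der d t (C a)) = D (aevalAeval y (D y) (C a)) := by
        induction a using Polynomial.induction_on' with
        | add p q hp hq => simp only [map_add, hp, hq]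
        | monomial n a =>
          rw [← C_mul_X_pow_eq_monomial, map_mul, map_pow, Derivation.leibniz,
            Derivation.leibniz_pow, der_C_C, der_C_X]
          simp [Derivation.leibniz, Derivation.leibniz_pow, hdD]
          ring
      simp only [← C_mul_X_pow_eq_monomial, Derivation.leibniz, Derivation.leibniz_pow, der_X,
        map_mul, map_pow, map_add, smul_eq_mul, nsmul_eq_mul, map_natCast, hC]
      simp [hy]
  have hker : RingHom.ker (aevalAeval (R := K) y (D y)) ≠ ⊥ := by
    intro h0
    apply hind
    rw [algebraicIndependent_iff_injective_aeval]
    have hcomp : MvPolynomial.aeval (R := K) ![y, D y] =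
        (aevalAeval (R := K) y (D y)).comp (Bivariate.equivMvPolynomial K).symm.toAlgHom := by
      ext i
      fin_cases i <;> simp [Bivariate.equivMvPolynomial]
    rw [hcomp]
    exact ((RingHom.injective_iff_ker_eq_bot _).mpr h0).comp
      (Bivariate.equivMvPolynomial K).symm.injective
  obtain ⟨P, hPker, hPprime⟩ := (RingHom.ker_isPrime _).exists_mem_prime_of_ne_bot hker
  obtain ⟨hpos, hdvd⟩ := dvd_of_aevalAeval_eq_zero halg hPprime.irreducible hPker
  refine hpos.ne' (natDegree_eq_zero_of_dvd_der d t ht (hdvd _ ?_))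
  rw [hD, show aevalAeval y (D y) P = 0 from hPker, map_zero]

end PainleveI

/-- Strong minimality of the first Painlevé equation (Fact 3.2 / Proposition 3.1):
if `y` is a solution of `y'' = 6y² + t` in a differential field extension `L` of `ℂ(t)`
and `K` is a differential subfield of `L`, then either `y` is algebraic over `K`
or `y, y'` are algebraically independent over `K`. -/
theorem painleveI_strongly_minimal
    (L : Type*) [Field L] [Algebra ℂ L]
    (D : L → L)
    (hD_add : ∀ a b : L, D (a + b) = D a + D b)
    (hD_mul : ∀ a b : L, D (a * b) = a * D b + b * D a)
    (hD_const : ∀ c : ℂ, D (algebraMap ℂ L c) = 0)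
    (t : L) (hDt : D t = 1)
    (K : Subfield L)
    (hK_const : ∀ c : ℂ, algebraMap ℂ L c ∈ K)
    (hK_t : t ∈ K)
    (hK_D : ∀ a ∈ K, D a ∈ K)
    (y : L)
    (hy : D (D y) = 6 * y ^ 2 + t) :
    IsAlgebraic K y ∨ AlgebraicIndependent K ![y, D y] := by
  have hD0 : D 0 = 0 := by simpa using hD_add 0 0
  let DL : Derivation ℤ L L :=
    Derivation.mk' (AddMonoidHom.toIntLinearMap ⟨⟨D, hD0⟩, hD_add⟩) hD_mul
  let dK : Derivation ℤ K K :=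
    Derivation.mk' (AddMonoidHom.toIntLinearMap
      ⟨⟨fun a => ⟨D a, hK_D a a.2⟩, Subtype.ext hD0⟩, fun a b => Subtype.ext (hD_add a b)⟩)
      fun a b => Subtype.ext (hD_mul a b)
  have : CharZero L := charZero_of_injective_algebraMap (algebraMap ℂ L).injective
  exact PainleveI.isAlgebraic_or_algebraicIndependent dK DL (fun a => rfl) (t := ⟨t, hK_t⟩)
    (Subtype.ext hDt) hy
end

section
/- Let α ∈ ℂ. The following are equivalent: (i) for every differential field extension L of ℂ(t), every differential subfield K of L, and every y ∈ L satisfying the second Painlevé equation y'' = 2y³ + t·y + α, either y is algebraic over K or y, y' are algebraically independent over K; (ii) α ∉ 1/2 + ℤ, i.e. there is no integer n with α = 1/2 + n. (Corollary 3.5: the solution set of P_II(α) is strongly minimal if and only if α ∉ 1/2 + ℤ; failure of (i) when α ∈ 1/2 + ℤ corresponds to the solution set containing a definable subset of order 1.) -/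
section DarbouxPolynomials

open MvPolynomial

theorem exists_prime_ker_eq_span {K L S : Type*} [Field K] [Field L] [Algebra K L] [CommRing S]
    [Algebra K S] (e : S ≃ₐ[K] MvPolynomial (Fin 2) K) (φ : S →ₐ[K] L)
    (hφ : RingHom.ker φ ≠ ⊥) (s : S) (hs : Transcendental K (φ s)) :
    ∃ F : S, Prime F ∧ RingHom.ker φ = Ideal.span {F} := by
  have : IsDomain S := e.toMulEquiv.isDomain (MvPolynomial (Fin 2) K)
  have : UniqueFactorizationMonoid S := e.symm.toMulEquiv.uniqueFactorizationMonoid inferInstance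
  have : IsNoetherianRing S := isNoetherianRing_of_ringEquiv _ e.symm.toRingEquiv
  have hft : Algebra.FiniteType K S := Algebra.FiniteType.equiv inferInstance e.symm
  have hdim : ringKrullDim S = 2 := by
    rw [ringKrullDim_eq_of_ringEquiv e.toRingEquiv, MvPolynomial.ringKrullDim_of_isNoetherianRing]
    simp
  have hP : (RingHom.ker φ).IsPrime := RingHom.ker_isPrime φ
  obtain ⟨F, hFP, hF⟩ := hP.exists_mem_prime_of_ne_bot hφ
  refine ⟨F, hF, ?_⟩
  by_contra hne
  have hFI : (Ideal.span {F}).IsPrime := (Ideal.span_singleton_prime hF.ne_zero).2 hF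
  have hlt : Ideal.span {F} < RingHom.ker φ :=
    lt_of_le_of_ne ((Ideal.span_singleton_le_iff_mem _).2 hFP) (Ne.symm hne)
  have hnm : ¬ (RingHom.ker φ).IsMaximal := by
    intro hmax
    let := Ideal.Quotient.field (RingHom.ker φ)
    have : Module.Finite K (S ⧸ RingHom.ker φ) := finite_of_finite_type_of_isJacobsonRing K _
    have h1 : IsAlgebraic K (Ideal.Quotient.mk (RingHom.ker φ) s) := Algebra.IsAlgebraic.isAlgebraic _
    exact hs (h1.algHom (Ideal.Quotient.liftₐ (RingHom.ker φ) φ fun a ha => ha))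
  obtain ⟨m, hm, hPm⟩ := Ideal.exists_le_maximal _ hP.ne_top
  have hlt' : RingHom.ker φ < m := lt_of_le_of_ne hPm fun h => hnm (h ▸ hm)
  let p0 : PrimeSpectrum S := ⟨⊥, Ideal.isPrime_bot⟩
  let p1 : PrimeSpectrum S := ⟨_, hFI⟩
  let p2 : PrimeSpectrum S := ⟨_, hP⟩
  let p3 : PrimeSpectrum S := ⟨m, hm.isPrime⟩
  have h01 : p0 < p1 := show (⊥ : Ideal S) < _ from
    bot_lt_iff_ne_bot.2 (by simpa [p1] using hF.ne_zero)
  have h12 : p1 < p2 := hlt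
  have h23 : p2 < p3 := hlt'
  let c : LTSeries (PrimeSpectrum S) :=
    ⟨3, ![p0, p1, p2, p3], by intro i; fin_cases i <;> assumption⟩
  have h2 : ((c.length : ℕ) : WithBot ℕ∞) ≤ 2 := hdim ▸ Order.LTSeries.length_le_krullDim c
  have h3 : ((3 : ℕ) : WithBot ℕ∞) ≤ (2 : ℕ) := h2
  norm_cast at h3

namespace QuadraticAlgebra

variable {K R A : Type*} [CommSemiring K] [CommRing R] [CommRing A] [Algebra K R] [Algebra K A]

/-- The algebra map out of `R[√a]` extending `f : R →ₐ[K] A` and sending `√a` to `u`. -/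
@[simps]
def liftAlgHom {a : R} (f : R →ₐ[K] A) (u : A) (hu : u * u = f a) :
    QuadraticAlgebra R a 0 →ₐ[K] A where
  toFun z := f z.re + u * f z.im
  map_zero' := by simp
  map_one' := by simp [re_one, im_one]
  map_add' z w := by simp; ring
  map_mul' z w := by simp; linear_combination - f z.im * f w.im * hu
  commutes' r := by
    simp [IsScalarTower.algebraMap_apply K R (QuadraticAlgebra R a 0)]

end QuadraticAlgebra

/-- `K[u, v][y]` with `y² = (v - u - t) / 2`. -/
abbrev CurveRing (K : Type*) [Field K] (t : K) :=
  QuadraticAlgebra (MvPolynomial (Fin 2) K) (C (1 / 2) * (X 1 - X 0 - C t)) 0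

/-- `K[u, v][y]` is the polynomial ring in `u` and `y`. -/
noncomputable def curveRingEquiv (K : Type*) [Field K] [CharZero K] (t : K) :
    CurveRing K t ≃ₐ[K] MvPolynomial (Fin 2) K :=
  AlgEquiv.ofAlgHom
    (QuadraticAlgebra.liftAlgHom (aeval ![X 0, X 0 + 2 * X 1 ^ 2 + C t]) (X 1) (by
      have : (C (1 / 2) * 2 : MvPolynomial (Fin 2) K) = 1 := by
        rw [show (2 : MvPolynomial (Fin 2) K) = C 2 from (map_ofNat C 2).symm, ← C_mul]; simp
      simp only [map_mul, map_sub, aeval_X, aeval_C, MvPolynomial.algebraMap_eq, Matrix.cons_val]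
      linear_combination - X 1 ^ 2 * this))
    (aeval ![⟨X 0, 0⟩, ⟨0, 1⟩])
    (by
      ext i
      fin_cases i <;> simp)
    (by
      have h2 : (2 : MvPolynomial (Fin 2) K) * C 2⁻¹ = 1 := by
        rw [show (2 : MvPolynomial (Fin 2) K) = C 2 from (map_ofNat C 2).symm, ← C_mul]; simp
      apply AlgHom.ext
      have h : ((aeval ![⟨X 0, 0⟩, ⟨0, 1⟩] : _ →ₐ[K] CurveRing K t).comp
          (aeval ![X 0, X 0 + 2 * X 1 ^ 2 + C t] : _ →ₐ[K] MvPolynomial (Fin 2) K)) =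
          IsScalarTower.toAlgHom K (MvPolynomial (Fin 2) K) (CurveRing K t) := by
        ext i : 1
        fin_cases i
        · simp [QuadraticAlgebra.algebraMap_eq]
        · simp [QuadraticAlgebra.algebraMap_eq]
          have e : algebraMap K (CurveRing K t) t = ⟨C t, 0⟩ := rfl
          rw [e, QuadraticAlgebra.ext_iff]
          simp only [pow_two, QuadraticAlgebra.mk_mul_mk, QuadraticAlgebra.re_add,
            QuadraticAlgebra.im_add, QuadraticAlgebra.re_mul, QuadraticAlgebra.im_mul,
            QuadraticAlgebra.re_ofNat, QuadraticAlgebra.im_ofNat, one_div]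
          exact ⟨by linear_combination (X 1 - X 0 - C t) * h2, by ring⟩
      intro z
      have h1 := fun p => DFunLike.congr_fun h p
      simp only [AlgHom.comp_apply, QuadraticAlgebra.liftAlgHom_apply, map_add, map_mul] at h1 ⊢
      rw [h1, h1]
      ext1 <;> simp)

theorem chain_eq_zero {K : Type*} [Field K] [CharZero K] (b : ℤ → K) (w : K) (N : ℤ)
    (hlo : ∀ i < 0, b i = 0) (hhi : ∀ i, N < i → b i = 0)
    (h : ∀ i : ℤ, (-3 / 2 - (w - 2 * i)) * b (i - 1) + (1 / 2 + (w - 2 * i)) * b i = 0) (i : ℤ) :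
    b i = 0 := by
  by_contra hi
  obtain ⟨m, hm, hmin⟩ := Int.exists_least_of_bdd (P := fun i => b i ≠ 0)
    ⟨0, fun z hz => not_lt.1 fun hlt => hz (hlo z hlt)⟩ ⟨i, hi⟩
  obtain ⟨M, hM, hmax⟩ := Int.exists_greatest_of_bdd (P := fun i => b i ≠ 0)
    ⟨N, fun z hz => not_lt.1 fun hlt => hz (hhi z hlt)⟩ ⟨i, hi⟩
  have h1 : b (m - 1) = 0 := by
    by_contra hc
    have := hmin _ hc
    omega
  have h2 : b (M + 1) = 0 := by
    by_contra hc
    have := hmax _ hc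
    omega
  have e1 := h m
  have e2 := h (M + 1)
  rw [h1, mul_zero, zero_add, mul_eq_zero, or_iff_left hm] at e1
  rw [h2, mul_zero, add_zero, add_sub_cancel_right, mul_eq_zero, or_iff_left hM] at e2
  have hle := hmin M hM
  have : (2 * (M - m) + 1 : K) = 0 := by push_cast at e2; linear_combination e1 + e2
  have : (2 * (M - m) + 1 : ℤ) = 0 := by exact_mod_cast this
  omega

theorem chain_eq_zero_of_int {K : Type*} [Field K] [CharZero K] (b : ℤ → K) (N w lo hi : ℤ)
    (hlo : ∀ i < 0, b i = 0) (hhi : ∀ i, N < i → b i = 0)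
    (h : ∀ i : ℤ, i < lo ∨ hi < i → (-3 / 2 - (w - 2 * i)) * b (i - 1)
      + (1 / 2 + (w - 2 * i)) * b i = 0) (i : ℤ) (hi' : i < lo ∨ hi ≤ i) : b i = 0 := by
  have hp (i : ℤ) : (-3 / 2 - (w - 2 * i) : K) ≠ 0 := by
    intro hc
    have : ((-3 - 2 * (w - 2 * i) : ℤ) : K) = 0 := by
      push_cast at hc ⊢; linear_combination 2 * hc
    have := Int.cast_eq_zero.1 this
    omega
  have hq (i : ℤ) : (1 / 2 + (w - 2 * i) : K) ≠ 0 := by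
    intro hc
    have : ((1 + 2 * (w - 2 * i) : ℤ) : K) = 0 := by
      push_cast at hc ⊢; linear_combination 2 * hc
    have := Int.cast_eq_zero.1 this
    omega
  have up (n : ℕ) : ∀ i < lo, i < n → b i = 0 := by
    induction n with
    | zero => intro i _ hi; exact hlo i (by simpa using hi)
    | succ n ih =>
      intro i hia hi
      have e := h i (Or.inl hia)
      rw [ih (i - 1) (by omega) (by push_cast at hi; omega), mul_zero, zero_add, mul_eq_zero] at e
      exact e.resolve_left (hq i)
  have down (n : ℕ) : ∀ i, hi ≤ i → N - n < i → b i = 0 := by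
    induction n with
    | zero => intro i _ hi; exact hhi i (by simpa using hi)
    | succ n ih =>
      intro i hia hi
      have e := h (i + 1) (by omega)
      rw [ih (i + 1) (by omega) (by push_cast at hi; omega), mul_zero, add_zero, mul_eq_zero,
        add_sub_cancel_right] at e
      exact e.resolve_left (hp _)
  rcases hi' with hi | hi
  · exact up (i + 1).toNat i hi (by omega)
  · exact down (N - i + 1).toNat i hi (by omega)

/-- The leading-term analysis of a Darboux polynomial `A(u, v) + y B(u, v)` with cofactor
`2 γ y + h`, on coefficient arrays. -/
theorem exists_exponents_of_coeff_eqs {K : Type*} [Field K] [CharZero K] (d : K → K) (d0 : d 0 = 0)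
    (cm cp γ h t : K) (A B : ℤ → ℤ → K) (N : ℤ)
    (hA : ∀ i j, N < i + j → A i j = 0) (hB : ∀ i j, N < i + j → B i j = 0)
    (hAneg : ∀ i j, i < 0 ∨ j < 0 → A i j = 0) (hBneg : ∀ i j, i < 0 ∨ j < 0 → B i j = 0)
    (hne : ∃ i j, i + j = N ∧ (A i j ≠ 0 ∨ B i j ≠ 0))
    (E1 : ∀ i j : ℤ, d (A i j) + cm * (i + 1) * A (i + 1) j + cp * (j + 1) * A i (j + 1)
      + (1 / 2 - (j - i + 1 - γ)) * B (i - 1) j + (1 / 2 + (j - 1 - i - γ)) * B i (j - 1)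
      - t * (j - i - γ) * B i j = h * A i j)
    (E2 : ∀ i j : ℤ, d (B i j) + 2 * (j - i - γ) * A i j + cm * (i + 1) * B (i + 1) j
      + cp * (j + 1) * B i (j + 1) = h * B i j) :
    ∃ a b : ℤ, 0 ≤ a ∧ 0 ≤ b ∧ a + b = N ∧ (∀ i j, i + j = N → B i j = 0) ∧ a * cm = b * cp := by
  have hBN : ∀ i j, i + j = N → B i j = 0 := by
    intro i j hij
    have := chain_eq_zero (fun i => B i (N - i)) (N - γ) N
      (fun i hi => hBneg _ _ (Or.inl hi)) (fun i hi => hBneg _ _ (Or.inr (by omega))) (by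
        intro i
        have e := E1 i (N - i + 1)
        rw [hA i _ (by omega), hA (i + 1) _ (by omega), hA i _ (by omega), hB i (N - i + 1) (by omega),
          d0, add_sub_cancel_right] at e
        rw [show N - (i - 1) = N - i + 1 by ring]
        push_cast at e
        linear_combination e) i
    rwa [show N - i = j by omega] at this
  have hBN' : ∀ i j, N - 1 < i + j → B i j = 0 := fun i j hij => by
    rcases (show N = i + j ∨ N < i + j by omega) with h | h
    · exact hBN i j h.symm
    · exact hB i j h
  obtain ⟨a, b, hab, hAB⟩ := hne
  have hAab : A a b ≠ 0 := hAB.resolve_right (not_not.2 (hBN a b hab))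
  have hγ : γ = b - a := by
    have e := E2 a b
    rw [hBN a b hab, hB (a + 1) b (by omega), hB a (b + 1) (by omega), d0] at e
    have : (b - a - γ) * A a b = 0 := by linear_combination e / 2
    linear_combination -(mul_eq_zero.1 this).resolve_right hAab
  subst hγ
  have hγ0 : ∀ i j : ℤ, j - i ≠ b - a → (j - i - (b - a) : K) ≠ 0 := by
    intro i j hij hc
    apply hij
    rw [← sub_eq_zero]
    exact_mod_cast hc
  have hA0 : ∀ i j, j - i ≠ b - a → B i j = 0 → B (i + 1) j = 0 → B i (j + 1) = 0 →
      A i j = 0 := by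
    intro i j hij h1 h2 h3
    have e := E2 i j
    rw [h1, h2, h3, d0] at e
    have : (j - i - (b - a) : K) * A i j = 0 := by linear_combination e / 2
    exact (mul_eq_zero.1 this).resolve_left (hγ0 i j hij)
  have hAtop : ∀ i j, i + j = N → i ≠ a → A i j = 0 := fun i j hij hia =>
    hA0 i j (by omega) (hBN' _ _ (by omega)) (hBN' _ _ (by omega)) (hBN' _ _ (by omega))
  have hBN1 : ∀ i j, i + j = N - 1 → B i j = 0 := by
    intro i j hij
    have := chain_eq_zero_of_int (fun i => B i (N - 1 - i)) N (2 * a - 1) a a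
      (fun i hi => hBneg _ _ (Or.inl hi)) (fun i hi => hBneg _ _ (Or.inr (by omega))) (by
        intro i hia
        replace hia : i ≠ a := by omega
        have e := E1 i (N - i)
        rw [hAtop i _ (by omega) hia, hA (i + 1) _ (by omega), hA i _ (by omega),
          hBN i (N - i) (by omega), d0, show N - i - 1 = N - 1 - i by ring] at e
        rw [show N - 1 - (i - 1) = N - i by ring]
        have hN : (N : K) = a + b := by rw [← hab]; push_cast; ring
        push_cast at e ⊢
        rw [hN] at e
        linear_combination e) i (by omega)
    rwa [show N - 1 - i = j by omega] at this
  have hAN1 : ∀ i j, i + j = N - 1 → A i j = 0 := fun i j hij =>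
    hA0 i j (by omega) (hBN1 i j hij) (hBN' _ _ (by omega)) (hBN' _ _ (by omega))
  have ha : 0 ≤ a := not_lt.1 fun hlt => hAab (hAneg _ _ (Or.inl hlt))
  have hb : 0 ≤ b := not_lt.1 fun hlt => hAab (hAneg _ _ (Or.inr hlt))
  refine ⟨a, b, ha, hb, hab, hBN, ?_⟩
  have hBN2 : ∀ i j, i + j = N - 2 → i ≠ a - 1 → B i j = 0 := by
    intro i j hij hia
    have := chain_eq_zero_of_int (fun i => B i (N - 2 - i)) N (2 * a - 2) (a - 1) a
      (fun i hi => hBneg _ _ (Or.inl hi)) (fun i hi => hBneg _ _ (Or.inr (by omega))) (by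
        intro i hia
        have e := E1 i (N - 1 - i)
        rw [hAtop (i + 1) _ (by omega) (by omega), hAtop i (N - 1 - i + 1) (by omega) (by omega),
          hAN1 i _ (by omega), hBN1 i (N - 1 - i) (by omega), d0,
          show N - 1 - i - 1 = N - 2 - i by ring] at e
        rw [show N - 2 - (i - 1) = N - 1 - i by ring]
        have hN : (N : K) = a + b := by rw [← hab]; push_cast; ring
        push_cast at e ⊢
        rw [hN] at e
        linear_combination e) i (by omega)
    rwa [show N - 2 - i = j by omega] at this
  have e1 := E1 (a - 1) b
  have e2 := E1 a (b - 1)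
  rw [hAN1 (a - 1) b (by omega), hBN1 (a - 1) b (by omega), hAtop (a - 1) _ (by omega) (by omega),
    sub_add_cancel, d0, hBN2 (a - 1 - 1) b (by omega) (by omega)] at e1
  rw [hAN1 a (b - 1) (by omega), hBN1 a (b - 1) (by omega), hAtop (a + 1) _ (by omega) (by omega),
    sub_add_cancel, d0, hBN2 a (b - 1 - 1) (by omega) (by omega)] at e2
  push_cast at e1 e2
  have : (a * cm - b * cp) * A a b = 0 := by linear_combination e1 - e2
  exact sub_eq_zero.1 ((mul_eq_zero.1 this).resolve_right hAab)

/-- The coefficient of `u ^ i v ^ j`, extended by zero to integer exponents. -/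
noncomputable def zcoeff {K : Type*} [Field K] (i j : ℤ) : MvPolynomial (Fin 2) K →ₗ[K] K :=
  if 0 ≤ i ∧ 0 ≤ j then lcoeff K (Finsupp.single 0 i.toNat + Finsupp.single 1 j.toNat) else 0

section zcoeff

variable {K : Type*} [Field K]

theorem zcoeff_of_neg {i j : ℤ} (h : i < 0 ∨ j < 0) (p : MvPolynomial (Fin 2) K) :
    zcoeff i j p = 0 := by
  rw [zcoeff, if_neg (by omega), LinearMap.zero_apply]

theorem zcoeff_natCast (i j : ℕ) (p : MvPolynomial (Fin 2) K) :
    zcoeff (i : ℤ) j p = coeff (Finsupp.single 0 i + Finsupp.single 1 j) p := by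
  simp [zcoeff]

theorem single_add_single_fin_two (m : Fin 2 →₀ ℕ) :
    Finsupp.single 0 (m 0) + Finsupp.single 1 (m 1) = m := by
  ext i
  fin_cases i <;> simp

theorem zcoeff_C_mul (i j : ℤ) (a : K) (p : MvPolynomial (Fin 2) K) :
    zcoeff i j (C a * p) = a * zcoeff i j p := by
  rw [← smul_eq_C_mul, map_smul, smul_eq_mul]

theorem zcoeff_X_zero_mul (i j : ℤ) (p : MvPolynomial (Fin 2) K) :
    zcoeff i j (X 0 * p) = zcoeff (i - 1) j p := by
  rcases lt_or_ge i 0 with hi | hi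
  · rw [zcoeff_of_neg (by omega), zcoeff_of_neg (by omega)]
  rcases lt_or_ge j 0 with hj | hj
  · rw [zcoeff_of_neg (by omega), zcoeff_of_neg (by omega)]
  lift i to ℕ using hi
  lift j to ℕ using hj
  rw [zcoeff_natCast, coeff_X_mul']
  rcases i with _ | i
  · rw [zcoeff_of_neg (by simp)]
    simp
  · rw [show ((i + 1 : ℕ) : ℤ) - 1 = i by simp, zcoeff_natCast, if_pos (by simp)]
    congr 1
    ext k
    fin_cases k <;> simp

theorem zcoeff_X_one_mul (i j : ℤ) (p : MvPolynomial (Fin 2) K) :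
    zcoeff i j (X 1 * p) = zcoeff i (j - 1) p := by
  rcases lt_or_ge i 0 with hi | hi
  · rw [zcoeff_of_neg (by omega), zcoeff_of_neg (by omega)]
  rcases lt_or_ge j 0 with hj | hj
  · rw [zcoeff_of_neg (by omega), zcoeff_of_neg (by omega)]
  lift i to ℕ using hi
  lift j to ℕ using hj
  rw [zcoeff_natCast, coeff_X_mul']
  rcases j with _ | j
  · rw [zcoeff_of_neg (by simp)]
    simp
  · rw [show ((j + 1 : ℕ) : ℤ) - 1 = j by simp, zcoeff_natCast, if_pos (by simp)]
    congr 1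
    ext k
    fin_cases k <;> simp

theorem zcoeff_pderiv_zero (i j : ℤ) (p : MvPolynomial (Fin 2) K) :
    zcoeff i j (pderiv 0 p) = (i + 1) * zcoeff (i + 1) j p := by
  rcases lt_or_ge j 0 with hj | hj
  · rw [zcoeff_of_neg (by omega), zcoeff_of_neg (by omega), mul_zero]
  rcases lt_or_ge i 0 with hi | hi
  · rw [zcoeff_of_neg (by omega)]
    rcases eq_or_ne i (-1) with rfl | hi'
    · simp
    · rw [zcoeff_of_neg (by omega), mul_zero]
  lift i to ℕ using hi
  lift j to ℕ using hj
  rw [zcoeff_natCast, coeff_pderiv, show ((i : ℤ) + 1) = (i + 1 : ℕ) by simp, zcoeff_natCast]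
  rw [show Finsupp.single (0 : Fin 2) i + Finsupp.single 1 j + Finsupp.single 0 1 =
    Finsupp.single 0 (i + 1) + Finsupp.single 1 j by ext k; fin_cases k <;> simp]
  simp [mul_comm]

theorem zcoeff_pderiv_one (i j : ℤ) (p : MvPolynomial (Fin 2) K) :
    zcoeff i j (pderiv 1 p) = (j + 1) * zcoeff i (j + 1) p := by
  rcases lt_or_ge i 0 with hi | hi
  · rw [zcoeff_of_neg (by omega), zcoeff_of_neg (by omega), mul_zero]
  rcases lt_or_ge j 0 with hj | hj
  · rw [zcoeff_of_neg (by omega)]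
    rcases eq_or_ne j (-1) with rfl | hj'
    · simp
    · rw [zcoeff_of_neg (by omega), mul_zero]
  lift i to ℕ using hi
  lift j to ℕ using hj
  rw [zcoeff_natCast, coeff_pderiv, show ((j : ℤ) + 1) = (j + 1 : ℕ) by simp, zcoeff_natCast]
  rw [show Finsupp.single (0 : Fin 2) i + Finsupp.single 1 j + Finsupp.single 1 1 =
    Finsupp.single 0 i + Finsupp.single 1 (j + 1) by ext k; fin_cases k <;> simp]
  simp [mul_comm]

theorem sum_support_fin_two (m : Fin 2 →₀ ℕ) : ∑ i ∈ m.support, m i = m 0 + m 1 := by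
  rw [← Fin.sum_univ_two]
  exact Finset.sum_subset (Finset.subset_univ _) (by simp)

theorem zcoeff_eq_zero_of_totalDegree_lt {i j : ℤ} {p : MvPolynomial (Fin 2) K}
    (h : (p.totalDegree : ℤ) < i + j) : zcoeff i j p = 0 := by
  rcases lt_or_ge i 0 with hi | hi
  · exact zcoeff_of_neg (by omega) p
  rcases lt_or_ge j 0 with hj | hj
  · exact zcoeff_of_neg (by omega) p
  lift i to ℕ using hi
  lift j to ℕ using hj
  rw [zcoeff_natCast]
  apply coeff_eq_zero_of_totalDegree_lt
  rw [sum_support_fin_two]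
  simp
  omega

theorem totalDegree_le_of_zcoeff {n : ℕ} {p : MvPolynomial (Fin 2) K}
    (h : ∀ i j : ℤ, n < i + j → zcoeff i j p = 0) : p.totalDegree ≤ n := by
  refine Finset.sup_le fun m hm => ?_
  by_contra! hlt
  refine mem_support_iff.1 hm ?_
  have := h (m 0) (m 1) (by
    have : m.sum (fun _ e => e) = m 0 + m 1 := sum_support_fin_two m
    omega)
  rwa [zcoeff_natCast, single_add_single_fin_two] at this

theorem exists_zcoeff_ne_zero {p : MvPolynomial (Fin 2) K} (hp : p ≠ 0) :
    ∃ i j : ℤ, i + j = p.totalDegree ∧ zcoeff i j p ≠ 0 := by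
  by_contra! hc
  have hdeg : ∀ i j : ℤ, (p.totalDegree : ℤ) ≤ i + j → zcoeff i j p = 0 := fun i j hij => by
    rcases hij.eq_or_lt with h | h
    · exact hc i j h.symm
    · exact zcoeff_eq_zero_of_totalDegree_lt h
  rcases Nat.eq_zero_or_pos p.totalDegree with h0 | h0
  · rw [totalDegree_eq_zero_iff_eq_C] at h0
    have := hdeg (0 : ℕ) (0 : ℕ) (by rw [h0]; simp)
    rw [zcoeff_natCast] at this
    apply hp
    rw [h0]
    simpa using this
  · have := totalDegree_le_of_zcoeff (n := p.totalDegree - 1) (p := p) fun i j hij =>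
      hdeg i j (by omega)
    omega

end zcoeff

/-- The polynomial obtained by applying the additive map `d` to every coefficient. -/
noncomputable def mapCoeff {σ K : Type*} [Field K] (d : K →+ K) (p : MvPolynomial σ K) :
    MvPolynomial σ K :=
  ∑ m ∈ p.support, monomial m (d (coeff m p))

section mapCoeff

variable {σ K : Type*} [Field K] (d : K →+ K)

theorem coeff_mapCoeff (p : MvPolynomial σ K) (m : σ →₀ ℕ) :
    coeff m (mapCoeff d p) = d (coeff m p) := by
  classical
  rw [mapCoeff, coeff_sum]
  simp only [coeff_monomial, Finset.sum_ite_eq', mem_support_iff, ne_eq, ite_not]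
  split_ifs with h
  · rw [h, map_zero]
  · rfl

theorem mapCoeff_add (p q : MvPolynomial σ K) :
    mapCoeff d (p + q) = mapCoeff d p + mapCoeff d q := by
  ext m
  simp [coeff_mapCoeff]

theorem mapCoeff_C (a : K) : mapCoeff d (C a : MvPolynomial σ K) = C (d a) := by
  classical
  ext m
  rw [coeff_mapCoeff, coeff_C, coeff_C, apply_ite d, map_zero]

theorem mapCoeff_mul_X (p : MvPolynomial σ K) (i : σ) :
    mapCoeff d (p * X i) = mapCoeff d p * X i := by
  classical
  ext m
  rw [coeff_mapCoeff, coeff_mul_X', coeff_mul_X', coeff_mapCoeff, apply_ite d, map_zero]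

theorem zcoeff_mapCoeff (i j : ℤ) (p : MvPolynomial (Fin 2) K) :
    zcoeff i j (mapCoeff d p) = d (zcoeff i j p) := by
  unfold zcoeff
  split_ifs
  · simp [coeff_mapCoeff]
  · simp

end mapCoeff

theorem totalDegree_cofactor_eq_zero {σ K : Type*} [Field K] {A B P Q W : MvPolynomial σ K}
    (hW : W.totalDegree = 1) (hAB : ¬ (B = 0 ∧ A.totalDegree = 0))
    (h1 : (P * A + W * (Q * B)).totalDegree ≤ max A.totalDegree (B.totalDegree + 1))
    (h2 : (P * B + Q * A).totalDegree ≤ max A.totalDegree B.totalDegree) :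
    P.totalDegree = 0 ∧ Q.totalDegree = 0 := by
  have hne : ∀ {p : MvPolynomial σ K}, p.totalDegree ≠ 0 → p ≠ 0 := by
    rintro p hp rfl
    simp at hp
  have hW0 : W ≠ 0 := hne (by omega)
  have b1 := totalDegree_mul Q B
  have b2 := totalDegree_mul W (Q * B)
  have b3 := totalDegree_mul P B
  have b4 := totalDegree_mul Q A
  have b5 := totalDegree_mul P A
  rcases lt_or_ge B.totalDegree A.totalDegree with hlt | hle
  · have hA : A ≠ 0 := hne (by omega)
    rcases lt_or_ge Q.totalDegree P.totalDegree with hc | hc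
    · have := totalDegree_mul_of_isDomain (hne (by omega) : P ≠ 0) hA
      rw [totalDegree_add_eq_left_of_totalDegree_lt (by omega)] at h1
      omega
    · by_contra h0
      have := totalDegree_mul_of_isDomain (hne (by omega) : Q ≠ 0) hA
      rw [totalDegree_add_eq_right_of_totalDegree_lt (by omega)] at h2
      omega
  · have hB : B ≠ 0 := by
      rintro rfl
      simp at hle hAB
      omega
    rcases lt_or_ge Q.totalDegree P.totalDegree with hc | hc
    · have := totalDegree_mul_of_isDomain (hne (by omega) : P ≠ 0) hB
      rw [totalDegree_add_eq_left_of_totalDegree_lt (by omega)] at h2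
      omega
    · by_contra h0
      have hQ : Q ≠ 0 := hne (by omega)
      have := totalDegree_mul_of_isDomain hQ hB
      have := totalDegree_mul_of_isDomain hW0 (mul_ne_zero hQ hB)
      rw [totalDegree_add_eq_right_of_totalDegree_lt (by omega)] at h1
      omega

/-- The vector field of the second Painlevé equation on `K[u, v][y]`, where
`u = y' - y² - t / 2` and `v = y' + y² + t / 2` satisfy `u' = -2 y u + cm`, `v' = 2 y v + cp`. -/
noncomputable def curveDeriv {K : Type*} [Field K] (d : K →+ K) (t cm cp : K)
    (F : CurveRing K t) : CurveRing K t :=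
  let θ (A : MvPolynomial (Fin 2) K) := X 1 * pderiv 1 A - X 0 * pderiv 0 A
  let δ (A : MvPolynomial (Fin 2) K) := C cm * pderiv 0 A + C cp * pderiv 1 A
  ⟨mapCoeff d F.re + δ F.re + C (1 / 2) * (X 0 * F.im + X 1 * F.im)
      + (X 1 * θ F.im - X 0 * θ F.im - C t * θ F.im),
    mapCoeff d F.im + C 2 * θ F.re + δ F.im⟩

theorem totalDegree_curve_coeff {K : Type*} [Field K] [CharZero K] (t : K) :
    (C (1 / 2) * (X 1 - X 0 - C t) : MvPolynomial (Fin 2) K).totalDegree = 1 := by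
  set W : MvPolynomial (Fin 2) K := C (1 / 2) * (X 1 - X 0 - C t)
  apply le_antisymm
  · refine (totalDegree_mul _ _).trans ?_
    rw [totalDegree_C, zero_add]
    refine (totalDegree_sub_C_le _ _).trans ((totalDegree_sub _ _).trans ?_)
    simp
  · by_contra! h
    have h1 : zcoeff 0 1 W = 0 := zcoeff_eq_zero_of_totalDegree_lt (by omega)
    have e : W = C (1 / 2) * (X 1 * C 1 - X 0 * C 1 - C t) := by simp [W]
    have hs : ¬ ((0 : Fin 2 →₀ ℕ) = Finsupp.single 0 0 + Finsupp.single 1 1) := fun hc => by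
      simpa using DFunLike.congr_fun hc 1
    rw [e, zcoeff_C_mul, map_sub, map_sub, zcoeff_X_one_mul, zcoeff_X_zero_mul,
      zcoeff_of_neg (i := 0 - 1) (by simp), show (1 : ℤ) - 1 = (0 : ℕ) by simp,
      show (0 : ℤ) = (0 : ℕ) by simp, show (1 : ℤ) = (1 : ℕ) by simp, zcoeff_natCast,
      zcoeff_natCast, coeff_C, coeff_C, if_neg hs] at h1
    simp at h1

/-- Exponents of the leading form of a Darboux polynomial of the second Painlevé equation. -/
theorem exists_exponents_of_curveDeriv_eq {K : Type*} [Field K] [CharZero K] (d : K →+ K)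
    (t cm cp : K) (F G : CurveRing K t) (h0 : F ≠ 0) (hF : ¬ IsUnit F)
    (h : curveDeriv d t cm cp F = G * F) :
    ∃ a b : ℤ, 0 ≤ a ∧ 0 ≤ b ∧ 0 < a + b ∧ a * cm = b * cp := by
  obtain ⟨A, B⟩ := F
  obtain ⟨P, Q⟩ := G
  rw [curveDeriv, QuadraticAlgebra.ext_iff] at h
  simp only [QuadraticAlgebra.re_mul, QuadraticAlgebra.im_mul, zero_mul, add_zero] at h
  obtain ⟨h1, h2⟩ := h
  set n := A.totalDegree with hn
  set m := B.totalDegree with hm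
  have hA : ∀ {i j : ℤ}, (n : ℤ) < i + j → zcoeff i j A = 0 := zcoeff_eq_zero_of_totalDegree_lt
  have hB : ∀ {i j : ℤ}, (m : ℤ) < i + j → zcoeff i j B = 0 := zcoeff_eq_zero_of_totalDegree_lt
  have hAB : ¬ (B = 0 ∧ A.totalDegree = 0) := by
    rintro ⟨rfl, hA0⟩
    rw [totalDegree_eq_zero_iff_eq_C] at hA0
    apply hF
    have ha : coeff 0 A ≠ 0 := by
      intro hc
      apply h0
      rw [hA0, hc, map_zero]
      rfl
    have : (⟨A, 0⟩ : CurveRing K t) = algebraMap K _ (coeff 0 A) := by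
      conv_lhs => rw [hA0]
      rfl
    rw [this]
    exact (IsUnit.mk0 _ ha).map _
  have hPQ := totalDegree_cofactor_eq_zero (P := P) (Q := Q) (totalDegree_curve_coeff t) hAB (by
      rw [← mul_assoc, ← h1, ← hn, ← hm]
      refine totalDegree_le_of_zcoeff fun i j hij => ?_
      simp only [map_add, map_sub, zcoeff_C_mul, zcoeff_X_zero_mul, zcoeff_X_one_mul,
        zcoeff_pderiv_zero, zcoeff_pderiv_one, zcoeff_mapCoeff]
      push_cast at hij
      simp (disch := omega) [hA, hB]) (by
      rw [← h2, ← hn, ← hm]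
      refine totalDegree_le_of_zcoeff fun i j hij => ?_
      simp only [map_add, map_sub, zcoeff_C_mul, zcoeff_X_zero_mul, zcoeff_X_one_mul,
        zcoeff_pderiv_zero, zcoeff_pderiv_one, zcoeff_mapCoeff]
      push_cast at hij
      simp (disch := omega) [hA, hB])
  rw [totalDegree_eq_zero_iff_eq_C, totalDegree_eq_zero_iff_eq_C] at hPQ
  rw [hPQ.1, hPQ.2] at h1 h2
  generalize coeff 0 P = p at h1 h2
  generalize coeff 0 Q = q at h1 h2
  obtain ⟨a, b, ha, hb, hab, hBN, hc⟩ := exists_exponents_of_coeff_eqs d (map_zero d) cm cp (q / 2) p t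
    (fun i j => zcoeff i j A) (fun i j => zcoeff i j B) (max n m : ℕ)
    (fun i j hij => hA (by push_cast at hij; omega)) (fun i j hij => hB (by push_cast at hij; omega))
    (fun i j hij => zcoeff_of_neg hij A) (fun i j hij => zcoeff_of_neg hij B)
    (by
      rcases lt_or_ge m n with hlt | hle
      · obtain ⟨i, j, hij, hne⟩ := exists_zcoeff_ne_zero (p := A) (by
          rintro rfl
          simp at hn
          omega)
        exact ⟨i, j, by omega, Or.inl hne⟩
      · obtain ⟨i, j, hij, hne⟩ := exists_zcoeff_ne_zero (p := B) (by
          rintro rfl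
          simp at hm hAB
          omega)
        exact ⟨i, j, by omega, Or.inr hne⟩)
    (by
      intro i j
      have e := congrArg (zcoeff i j) h1
      rw [mul_assoc (C (1 / 2)), mul_assoc (C (1 / 2)), mul_comm _ (C q), mul_assoc (C q), sub_mul, sub_mul] at e
      simp only [map_add, map_sub, zcoeff_C_mul, zcoeff_X_zero_mul, zcoeff_X_one_mul,
        zcoeff_pderiv_zero, zcoeff_pderiv_one, zcoeff_mapCoeff, sub_add_cancel] at e
      push_cast at e
      linear_combination e)
    (by
      intro i j
      have e := congrArg (zcoeff i j) h2
      simp only [map_add, map_sub, zcoeff_C_mul, zcoeff_X_zero_mul, zcoeff_X_one_mul,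
        zcoeff_pderiv_zero, zcoeff_pderiv_one, zcoeff_mapCoeff, sub_add_cancel] at e
      push_cast at e
      linear_combination e)
  refine ⟨a, b, ha, hb, ?_, hc⟩
  by_contra! hle
  apply hAB
  refine ⟨?_, by omega⟩
  by_contra hB0
  obtain ⟨i, j, hij, hne⟩ := exists_zcoeff_ne_zero hB0
  exact hne (hBN i j (by omega))

theorem painleveII_exists_exponents {K L : Type*} [Field K] [Field L] [CharZero K] [Algebra K L]
    (D : L → L) (hadd : ∀ a b : L, D (a + b) = D a + D b)
    (hmul : ∀ a b : L, D (a * b) = a * D b + b * D a) (d : K →+ K)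
    (hd : ∀ a, D (algebraMap K L a) = algebraMap K L (d a)) (t α : K) (ht : d t = 1) (y : L)
    (hy : D (D y) = 2 * y ^ 3 + algebraMap K L t * y + algebraMap K L α)
    (htr : Transcendental K y)
    (hdep : ¬ AlgebraicIndependent K ![D y - y ^ 2 - algebraMap K L (t / 2), y]) :
    ∃ a b : ℤ, 0 ≤ a ∧ 0 ≤ b ∧ 0 < a + b ∧ a * (α - 1 / 2) = b * (α + 1 / 2) := by
  have : CharZero L := charZero_of_injective_algebraMap (algebraMap K L).injective
  let Dh : L →+ L := AddMonoidHom.mk' D hadd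
  have hsub (a b : L) : D (a - b) = D a - D b := map_sub Dh a b
  set u := D y - y ^ 2 - algebraMap K L (t / 2) with hu
  set v := D y + y ^ 2 + algebraMap K L (t / 2) with hv
  have htd : D (algebraMap K L (t / 2)) = 1 / 2 := by
    have h2 : D (algebraMap K L (t / 2)) + D (algebraMap K L (t / 2)) = 1 := by
      rw [← hadd, ← map_add, add_halves, hd, ht, map_one]
    linear_combination h2 / 2
  have ht2 : algebraMap K L t = algebraMap K L (t / 2) + algebraMap K L (t / 2) := by
    rw [← map_add, add_halves]
  have h12 : algebraMap K L (1 / 2) = 1 / 2 := by rw [map_div₀, map_one, map_ofNat]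
  have hDu : D u = - (2 * y * u) + algebraMap K L (α - 1 / 2) := by
    rw [hu, hsub, hsub, htd, hy, pow_two, hmul, ht2, map_sub, h12]
    ring
  have hDv : D v = 2 * y * v + algebraMap K L (α + 1 / 2) := by
    rw [hv, hadd, hadd, htd, hy, pow_two, hmul, ht2, map_add, h12]
    ring
  let f : MvPolynomial (Fin 2) K →ₐ[K] L := aeval ![u, v]
  have hyy : y * y = f (C (1 / 2) * (X 1 - X 0 - C t)) := by
    simp only [f, map_mul, map_sub, aeval_X, aeval_C, Matrix.cons_val, hu, hv, ht2, h12]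
    ring
  let φ : CurveRing K t →ₐ[K] L := QuadraticAlgebra.liftAlgHom f y hyy
  have hker : RingHom.ker φ ≠ ⊥ := by
    intro hker
    apply hdep
    have hinj : Function.Injective φ := (RingHom.injective_iff_ker_eq_bot _).2 hker
    have e : (aeval ![u, y] : _ →ₐ[K] L) = φ.comp (curveRingEquiv K t).symm.toAlgHom := by
      ext i
      fin_cases i <;> simp [φ, f, curveRingEquiv]
    rw [AlgebraicIndependent, e]
    exact hinj.comp (curveRingEquiv K t).symm.injective
  obtain ⟨F, hF, hspan⟩ := exists_prime_ker_eq_span (curveRingEquiv K t) φ hker ⟨0, 1⟩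
    (by simpa [φ] using htr)
  have hD (A : MvPolynomial (Fin 2) K) : D (f A) = f (mapCoeff d A
      + (C (α - 1 / 2) * pderiv 0 A + C (α + 1 / 2) * pderiv 1 A))
      + 2 * y * f (X 1 * pderiv 1 A - X 0 * pderiv 0 A) := by
    have fC (a : K) : f (C a) = algebraMap K L a := by simp [f]
    have f0 : f (X 0) = u := by simp [f]
    have f1 : f (X 1) = v := by simp [f]
    induction A using MvPolynomial.induction_on with
    | C a => simp [mapCoeff_C, fC, hd]
    | add p q hp hq =>
      rw [map_add, hadd, hp, hq, mapCoeff_add]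
      simp only [map_add, map_sub, map_mul]
      ring
    | mul_X p i hp =>
      rw [map_mul, hmul, hp, mapCoeff_mul_X]
      fin_cases i
      · simp only [Fin.zero_eta, map_add, map_sub, map_mul, Derivation.leibniz,
          pderiv_X_self, smul_eq_mul, f0, f1, fC, hDu, pderiv_X_of_ne (i := (1 : Fin 2)) (j := 0) (by decide), map_one, map_zero]
        ring
      · simp only [Fin.mk_one, map_add, map_sub, map_mul, Derivation.leibniz,
          pderiv_X_self, smul_eq_mul, f0, f1, fC, hDv, pderiv_X_of_ne (i := (0 : Fin 2)) (j := 1) (by decide), map_one, map_zero]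
        ring
  have hφD (H : CurveRing K t) : φ (curveDeriv d t (α - 1 / 2) (α + 1 / 2) H) = D (φ H) := by
    have fC (a : K) : f (C a) = algebraMap K L a := by simp [f]
    have f0 : f (X 0) = u := by simp [f]
    have f1 : f (X 1) = v := by simp [f]
    have hz : D y = (u + v) / 2 := by
      simp only [hu, hv]
      ring
    have hw : y * y = (v - u - algebraMap K L t) / 2 := by
      simp only [hu, hv, ht2]
      ring
    simp only [φ, QuadraticAlgebra.liftAlgHom_apply, curveDeriv]
    rw [hadd, hmul, hD, hD]
    simp only [map_add, map_sub, map_mul, fC, f0, f1, h12, map_ofNat]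
    linear_combination (-f H.im) * hz - 2 * (v * f (pderiv 1 H.im) - u * f (pderiv 0 H.im)) * hw
  have hmem : curveDeriv d t (α - 1 / 2) (α + 1 / 2) F ∈ RingHom.ker φ := by
    have hF0 : φ F = 0 := by
      rw [← RingHom.mem_ker, hspan]
      exact Ideal.mem_span_singleton_self F
    rw [RingHom.mem_ker, hφD, hF0]
    exact map_zero Dh
  rw [hspan, Ideal.mem_span_singleton'] at hmem
  obtain ⟨G, hG⟩ := hmem
  obtain ⟨a, b, ha, hb, hab, hc⟩ :=
    exists_exponents_of_curveDeriv_eq d t _ _ F G hF.ne_zero hF.not_isUnit hG.symm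
  exact ⟨a, b, ha, hb, hab, hc⟩

end DarbouxPolynomials

section Dependence

open AlgebraicIndependent

theorem AlgebraicIndependent.matroid_indep_pair {K L : Type*} [Field K] [Field L] [Algebra K L]
    {x w : L} (h : x ≠ w) :
    (matroid K L).Indep {x, w} ↔ AlgebraicIndependent K ![x, w] := by
  have hinj : Function.Injective ![x, w] := by
    intro i j hij
    fin_cases i <;> fin_cases j <;> simp_all [eq_comm]
  rw [matroid_indep_iff, ← algebraicIndependent_subtype_range hinj, Matrix.range_cons_cons_empty]
  rfl

/-- Two elements algebraic over `K(y)` are algebraically dependent over `K`. -/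
theorem not_algebraicIndependent_of_isAlgebraic_adjoin {K L : Type*} [Field K] [Field L]
    [Algebra K L] {x w y : L} (hx : IsAlgebraic (IntermediateField.adjoin K {y}) x)
    (hw : IsAlgebraic (IntermediateField.adjoin K {y}) w) :
    ¬ AlgebraicIndependent K ![x, w] := by
  intro h
  have hne : x ≠ w := fun e => by
    simpa using h.injective (show ![x, w] 0 = ![x, w] 1 from e)
  rw [← matroid_indep_pair hne] at h
  have hsub : {x, w} ⊆ (matroid K L).closure {y} := by
    rw [matroid_closure_eq]
    rintro z (rfl | rfl)
    · exact IntermediateField.isAlgebraic_adjoin_iff.1 hx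
    · exact IntermediateField.isAlgebraic_adjoin_iff.1 hw
  have hle := (h.encard_le_eRk_of_subset hsub).trans
    (((matroid K L).eRk_closure_eq {y}).le.trans ((matroid K L).eRk_le_encard {y}))
  rw [Set.encard_pair hne, Set.encard_singleton] at hle
  exact absurd hle (by decide)

theorem isAlgebraic_adjoin_of_not_algebraicIndependent {K L : Type*} [Field K] [Field L]
    [Algebra K L] {x y : L} (hy : Transcendental K y) (h : ¬ AlgebraicIndependent K ![y, x]) :
    IsAlgebraic (IntermediateField.adjoin K {y}) x := by
  by_cases hne : y = x
  · rw [← hne]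
    exact isAlgebraic_algebraMap
      (⟨y, IntermediateField.mem_adjoin_simple_self K y⟩ : IntermediateField.adjoin K {y})
  · have hI : (matroid K L).Indep {y} := by
      rw [matroid_indep_iff]
      exact (algebraicIndependent_singleton_iff (⟨y, rfl⟩ : ({y} : Set L))).2 hy
    rw [← matroid_indep_pair hne, Set.pair_comm] at h
    have hmem : x ∈ (matroid K L).closure {y} := by
      rw [hI.mem_closure_iff']
      exact ⟨trivial, fun h' => absurd h' h⟩
    rw [matroid_closure_eq] at hmem
    exact IntermediateField.isAlgebraic_adjoin_iff.2 hmem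

end Dependence

/-- In characteristic zero the derivative of an algebraic element is algebraic. -/
theorem IsAlgebraic.of_derivation {K L : Type*} [Field K] [Field L] [CharZero K] [Algebra K L]
    (D : L → L) (hadd : ∀ a b : L, D (a + b) = D a + D b)
    (hmul : ∀ a b : L, D (a * b) = a * D b + b * D a)
    (hD : ∀ a : K, ∃ b : K, D (algebraMap K L a) = algebraMap K L b) {x : L}
    (hx : IsAlgebraic K x) : IsAlgebraic K (D x) := by
  open Polynomial in
  have key (p : K[X]) : ∃ q : K[X], D (aeval x p) = aeval x q + aeval x (derivative p) * D x := by
    induction p using Polynomial.induction_on with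
    | C a =>
      obtain ⟨b, hb⟩ := hD a
      exact ⟨C b, by simp [hb]⟩
    | add p q hp hq =>
      obtain ⟨p', hp⟩ := hp
      obtain ⟨q', hq⟩ := hq
      refine ⟨p' + q', ?_⟩
      rw [map_add, hadd, hp, hq, derivative_add, map_add, map_add]
      ring
    | monomial n a h =>
      obtain ⟨q, hq⟩ := h
      refine ⟨q * X, ?_⟩
      rw [pow_succ, ← mul_assoc, map_mul, hmul, hq, derivative_mul, aeval_X]
      simp
      ring
  have hi := hx.isIntegral
  obtain ⟨q, hq⟩ := key (minpoly K x)
  have h0 : D 0 = 0 := map_zero (AddMonoidHom.mk' D hadd)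
  rw [minpoly.aeval, h0] at hq
  have hne : Polynomial.aeval x (Polynomial.derivative (minpoly K x)) ≠ 0 :=
    (minpoly.irreducible hi).separable.aeval_derivative_ne_zero (minpoly.aeval K x)
  have e : D x = -Polynomial.aeval x q *
      (Polynomial.aeval x (Polynomial.derivative (minpoly K x)))⁻¹ := by
    field_simp
    linear_combination -hq
  have ha (p : Polynomial K) : IsAlgebraic K (Polynomial.aeval x p) := by
    rw [isAlgebraic_iff_isIntegral]
    exact adjoin_le_integralClosure hi (Polynomial.aeval_mem_adjoin_singleton K x)
  rw [e]
  exact (ha q).neg.mul (ha _).inv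

/-- `y` is a solution of the second Painlevé equation with parameter `β`, transcendental over `K`
and lying in `N` together with its derivative. -/
structure IsPainleveIISolution {L : Type*} [Field L] [Algebra ℂ L] (D : L → L) (t : L)
    (K N : Subfield L) (β : ℂ) (y : L) : Prop where
  mem : y ∈ N
  deriv_mem : D y ∈ N
  transcendental : Transcendental K y
  eq : D (D y) = 2 * y ^ 3 + t * y + algebraMap ℂ L β

/-- `D` is a derivation on `L`, constant on `ℂ`, with `D t = 1`, and `K ≤ N` are subfields of `L`
such that `K` is a differential field containing `ℂ` and `t`. -/
structure IsDifferentialTower {L : Type*} [Field L] [Algebra ℂ L] (D : L → L) (t : L)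
    (K N : Subfield L) : Prop where
  map_add (a b : L) : D (a + b) = D a + D b
  map_mul (a b : L) : D (a * b) = a * D b + b * D a
  map_const (c : ℂ) : D (algebraMap ℂ L c) = 0
  map_t : D t = 1
  map_mem : ∀ a ∈ K, D a ∈ K
  const_mem (c : ℂ) : algebraMap ℂ L c ∈ K
  t_mem : t ∈ K
  le : K ≤ N

section Backlund

variable {L : Type*} [Field L] [Algebra ℂ L] {D : L → L} {t : L} {K N : Subfield L} {β : ℂ} {y : L}

theorem IsPainleveIISolution.neg (hT : IsDifferentialTower D t K N)
    (h : IsPainleveIISolution D t K N β y) :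
    IsPainleveIISolution D t K N (-β) (-y) := by
  have hneg (a : L) : D (-a) = - D a := map_neg (AddMonoidHom.mk' D hT.map_add) a
  refine ⟨neg_mem h.mem, ?_, fun ha => h.transcendental (by simpa using ha.neg), ?_⟩
  · rw [hneg]
    exact neg_mem h.deriv_mem
  · rw [hneg, hneg, h.eq, map_neg]
    ring

/-- The Bäcklund transformation `y ↦ -y - (β + 1 / 2) / (y' + y² + t / 2)`. -/
theorem IsPainleveIISolution.exists_add_one (hT : IsDifferentialTower D t K N)
    (h : IsPainleveIISolution D t K N β y)
    (hβ : β + 1 / 2 ≠ 0) : ∃ y₁, IsPainleveIISolution D t K N (β + 1) y₁ := by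
  obtain ⟨hadd, hmul, hconst, ht, hKD, hC, htK, hKN⟩ := hT
  have : CharZero L := charZero_of_injective_algebraMap (algebraMap ℂ L).injective
  have hsub (a b : L) : D (a - b) = D a - D b := map_sub (AddMonoidHom.mk' D hadd) a b
  have hneg (a : L) : D (-a) = - D a := map_neg (AddMonoidHom.mk' D hadd) a
  have h0 : D 0 = 0 := map_zero (AddMonoidHom.mk' D hadd)
  have h12 : algebraMap ℂ L (1 / 2) = 1 / 2 := by rw [map_div₀, map_one, map_ofNat]
  set c := algebraMap ℂ L (β + 1 / 2) with hc
  have hc' : c = algebraMap ℂ L β + 1 / 2 := by rw [hc, map_add, h12]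
  have hc0 : c ≠ 0 := by rwa [hc, Ne, map_eq_zero]
  have ht2K : t / 2 ∈ K := div_mem htK (map_ofNat (algebraMap ℂ L) 2 ▸ hC 2)
  have ht2 : D (t / 2) = 1 / 2 := by
    have h2 : D (t / 2) + D (t / 2) = 1 := by rw [← hadd, add_halves, ht]
    linear_combination h2 / 2
  have hy2 (x : L) : D (x ^ 2) = 2 * x * D x := by
    rw [pow_two, hmul]
    ring
  set v := D y + y ^ 2 + t / 2 with hv
  have hDv : D v = 2 * y * v + c := by
    rw [hv, hadd, hadd, hy2, ht2, h.eq, hc']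
    ring
  have hv0 : v ≠ 0 := by
    intro e
    rw [e, h0] at hDv
    apply hc0
    linear_combination -hDv
  set y₁ := -y - c * v⁻¹ with hy₁
  have hinv : D v⁻¹ = -(2 * y * v + c) * (v⁻¹) ^ 2 := by
    have h1 : D (v * v⁻¹) = 0 := by
      rw [mul_inv_cancel₀ hv0, ← map_one (algebraMap ℂ L), hconst]
    rw [hmul, hDv] at h1
    field_simp at h1 ⊢
    linear_combination h1
  have hDy : D y = v - y ^ 2 - t / 2 := by
    rw [hv]
    ring
  have hDy₁ : D y₁ = y₁ ^ 2 + t / 2 - v := by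
    rw [hy₁, hsub, hneg, hmul, hinv, hconst, hDy]
    field_simp
    ring
  have hyv : y₁ * v = -y * v - c := by
    rw [hy₁]
    field_simp
  have hvN : v ∈ N := add_mem (add_mem h.deriv_mem (pow_mem h.mem 2)) (hKN ht2K)
  have hy₁N : y₁ ∈ N := sub_mem (neg_mem h.mem) (mul_mem (hKN (hC _)) (inv_mem hvN))
  refine ⟨y₁, hy₁N, ?_, ?_, ?_⟩
  · rw [hDy₁]
    exact sub_mem (add_mem (pow_mem hy₁N 2) (hKN ht2K)) hvN
  · intro ha
    have hDa : IsAlgebraic K (D y₁) :=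
      ha.of_derivation D hadd hmul fun a => ⟨⟨D a, hKD a a.2⟩, rfl⟩
    have hK {a : L} (h : a ∈ K) : IsAlgebraic K a := isAlgebraic_algebraMap (⟨a, h⟩ : K)
    have hva : IsAlgebraic K v := by
      rw [show v = y₁ ^ 2 + t / 2 - D y₁ by rw [hDy₁]; ring]
      exact ((ha.pow 2).add (hK ht2K)).sub hDa
    apply h.transcendental
    rw [show y = -y₁ - c * v⁻¹ by rw [hy₁]; ring]
    exact ha.neg.sub ((hK (hC _)).mul hva.inv)
  · rw [hDy₁, hsub, hadd, hy2, ht2, hDv, hDy₁, map_add, map_one]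
    linear_combination (-2) * hyv + hc'

theorem IsPainleveIISolution.exists_add_natCast (hT : IsDifferentialTower D t K N)
    (h : IsPainleveIISolution D t K N β y) (hβ : ∀ k : ℕ, β + k + 1 / 2 ≠ 0) (n : ℕ) :
    ∃ y₁, IsPainleveIISolution D t K N (β + n) y₁ := by
  induction n with
  | zero => exact ⟨y, by simpa using h⟩
  | succ n ih =>
    obtain ⟨y₁, h₁⟩ := ih
    rw [Nat.cast_succ, ← add_assoc]
    exact h₁.exists_add_one hT (hβ n)

theorem IsPainleveIISolution.exists_add_intCast (hT : IsDifferentialTower D t K N)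
    (h : IsPainleveIISolution D t K N β y) (hβ : ¬ ∃ k : ℤ, β = 1 / 2 + k) (n : ℤ) :
    ∃ y₁, IsPainleveIISolution D t K N (β + n) y₁ := by
  obtain ⟨m, rfl | rfl⟩ := n.eq_nat_or_neg
  · rw [Int.cast_natCast]
    refine h.exists_add_natCast hT (fun k hk => hβ ⟨-k - 1, ?_⟩) m
    push_cast
    linear_combination hk
  · obtain ⟨y₁, h₁⟩ := (h.neg hT).exists_add_natCast hT (fun k hk => hβ ⟨k, by
      push_cast
      linear_combination -hk⟩) m
    refine ⟨-y₁, ?_⟩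
    rw [show β + ((-m : ℤ) : ℂ) = -(-β + m) by push_cast; ring]
    exact h₁.neg hT

end Backlund

/-- The subfield of elements of `L` algebraic over `K(y)`. -/
noncomputable def Subfield.adjoinAlgebraicClosure {L : Type*} [Field L] (K : Subfield L) (y : L) :
    Subfield L :=
  (algebraicClosure (IntermediateField.adjoin K {y}) L).toSubfield

theorem Subfield.mem_adjoinAlgebraicClosure {L : Type*} [Field L] {K : Subfield L} {x y : L} :
    x ∈ K.adjoinAlgebraicClosure y ↔ IsAlgebraic (IntermediateField.adjoin K {y}) x :=
  mem_algebraicClosure_iff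

theorem Subfield.le_adjoinAlgebraicClosure {L : Type*} [Field L] (K : Subfield L) (y : L) :
    K ≤ K.adjoinAlgebraicClosure y := fun x hx =>
  mem_adjoinAlgebraicClosure.2 (isAlgebraic_algebraMap
    (algebraMap K (IntermediateField.adjoin K {y}) ⟨x, hx⟩))

theorem Subfield.self_mem_adjoinAlgebraicClosure {L : Type*} [Field L] (K : Subfield L) (y : L) :
    y ∈ K.adjoinAlgebraicClosure y :=
  mem_adjoinAlgebraicClosure.2 (isAlgebraic_algebraMap
    (⟨y, IntermediateField.mem_adjoin_simple_self K y⟩ : IntermediateField.adjoin K {y}))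

/-- A parameter in the strip `|Re β| ≤ 1 / 2` with a solution of order one is `± 1 / 2`. -/
theorem eq_half_or_of_exponents {β : ℂ} (hβ : |β.re| ≤ 1 / 2) {a b : ℤ} (ha : 0 ≤ a) (hb : 0 ≤ b)
    (hab : 0 < a + b) (h : (a : ℂ) * (β - 1 / 2) = b * (β + 1 / 2)) :
    β = 1 / 2 ∨ β = -(1 / 2) := by
  obtain ⟨h1, h2⟩ := abs_le.1 hβ
  have hre : (a : ℝ) * (β.re - 1 / 2) = b * (β.re + 1 / 2) := by
    have := congrArg Complex.re h
    simpa using this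
  have ha' : (0 : ℝ) ≤ a := by exact_mod_cast ha
  have hb' : (0 : ℝ) ≤ b := by exact_mod_cast hb
  have e1 : (a : ℝ) * (β.re - 1 / 2) = 0 :=
    le_antisymm (mul_nonpos_of_nonneg_of_nonpos ha' (by linarith))
      (hre ▸ mul_nonneg hb' (by linarith))
  have e2 : (b : ℝ) * (β.re + 1 / 2) = 0 := hre ▸ e1
  rcases eq_or_ne b 0 with rfl | hb0
  · left
    have ha0 : (a : ℂ) ≠ 0 := by
      norm_cast
      omega
    simpa [ha0, sub_eq_zero] using h
  · right
    have ha0 : a = 0 := by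
      by_contra ha0
      have e3 := (mul_eq_zero.1 e1).resolve_left (by exact_mod_cast ha0)
      have e4 := (mul_eq_zero.1 e2).resolve_left (by exact_mod_cast hb0)
      linarith
    subst ha0
    have hb0' : (b : ℂ) ≠ 0 := by exact_mod_cast hb0
    have h5 : β + 1 / 2 = 0 := by simpa [hb0'] using h.symm
    linear_combination h5

theorem painleveII_algebraicIndependent {α : ℂ} (hα : ¬ ∃ n : ℤ, α = 1 / 2 + (n : ℂ))
    {L : Type*} [Field L] [Algebra ℂ L] {D : L → L} {t : L} {K : Subfield L}
    (hT : ∀ N, K ≤ N → IsDifferentialTower D t K N) {y : L}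
    (hy : D (D y) = 2 * y ^ 3 + t * y + algebraMap ℂ L α) (htr : Transcendental K y) :
    AlgebraicIndependent K ![y, D y] := by
  by_contra hdep
  have hDy := isAlgebraic_adjoin_of_not_algebraicIndependent htr hdep
  set N := K.adjoinAlgebraicClosure y with hN
  have hKN : K ≤ N := K.le_adjoinAlgebraicClosure y
  have hTN := hT N hKN
  have hsol : IsPainleveIISolution D t K N α y := ⟨K.self_mem_adjoinAlgebraicClosure y,
    Subfield.mem_adjoinAlgebraicClosure.2 hDy, htr, hy⟩
  obtain ⟨z, hz⟩ := hsol.exists_add_intCast hTN hα (-round α.re)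
  set β := α + ((-round α.re : ℤ) : ℂ) with hβ
  have hre : |β.re| ≤ 1 / 2 := by
    have := abs_sub_round α.re
    simpa [hβ, sub_eq_add_neg] using this
  have : CharZero L := charZero_of_injective_algebraMap (algebraMap ℂ L).injective
  have h12 : algebraMap ℂ L (1 / 2) = 1 / 2 := by rw [map_div₀, map_one, map_ofNat]
  let d : K →+ K := AddMonoidHom.mk' (fun a => ⟨D a, hTN.map_mem a a.2⟩)
    fun a b => Subtype.ext (hTN.map_add a b)
  let t' : K := ⟨t, hTN.t_mem⟩
  let β' : K := ⟨algebraMap ℂ L β, hTN.const_mem β⟩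
  have ht2 : algebraMap K L (t' / 2) ∈ N := hKN (t' / 2).2
  obtain ⟨a, b, ha, hb, hab, he⟩ := painleveII_exists_exponents D hTN.map_add hTN.map_mul d
    (fun a => rfl) t' β' (Subtype.ext hTN.map_t) z hz.eq hz.transcendental
    (not_algebraicIndependent_of_isAlgebraic_adjoin
      (Subfield.mem_adjoinAlgebraicClosure.1
        (sub_mem (sub_mem hz.deriv_mem (pow_mem hz.mem 2)) ht2))
      (Subfield.mem_adjoinAlgebraicClosure.1 hz.mem))
  have he' : (a : ℂ) * (β - 1 / 2) = b * (β + 1 / 2) := by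
    apply (algebraMap ℂ L).injective
    have h := congrArg (algebraMap K L) he
    have hb' : algebraMap K L β' = algebraMap ℂ L β := rfl
    simp only [map_mul, map_sub, map_add, map_intCast, map_div₀, map_one, map_ofNat, hb'] at h ⊢
    exact h
  rcases eq_half_or_of_exponents hre ha hb hab he' with h | h
  · refine hα ⟨round α.re, ?_⟩
    rw [← h, hβ]
    push_cast
    ring
  · refine hα ⟨round α.re - 1, ?_⟩
    rw [hβ] at h
    push_cast at h ⊢
    linear_combination h

/-- A derivation of a domain extends to its fraction field. -/
theorem exists_extend_derivation {k R L : Type*} [Field k] [CommRing R] [IsDomain R] [Field L]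
    [Algebra k R] [Algebra R L] [Algebra k L] [IsScalarTower k R L] [IsFractionRing R L]
    (d : Derivation k R L) :
    ∃ D : L → L, (∀ a b, D (a + b) = D a + D b) ∧ (∀ a b, D (a * b) = a * D b + b * D a) ∧
      ∀ r, D (algebraMap R L r) = d r := by
  let g : R →+* TrivSqZeroExt L L :=
    { toFun := fun r => TrivSqZeroExt.inl (algebraMap R L r) + TrivSqZeroExt.inr (d r)
      map_one' := by ext <;> simp
      map_zero' := by ext <;> simp
      map_add' := fun a b => by ext <;> simp
      map_mul' := fun a b => by ext <;> simp [Algebra.smul_def (R := R) (A := L), mul_comm] }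
  have hg (r : nonZeroDivisors R) : IsUnit (g r) := by
    rw [TrivSqZeroExt.isUnit_iff_isUnit_fst]
    simp [g]
  let G : L →+* TrivSqZeroExt L L := IsLocalization.lift hg
  have hG (r : R) : G (algebraMap R L r) = g r := IsLocalization.lift_eq hg r
  have hfst (x : L) : (G x).fst = x := by
    have e : (TrivSqZeroExt.fstHom L L L).toRingHom.comp G = RingHom.id L := by
      apply IsLocalization.ringHom_ext (nonZeroDivisors R)
      ext r
      simp [hG, g]
    exact congrArg (fun f : L →+* L => f x) e
  refine ⟨fun x => (G x).snd, fun a b => ?_, fun a b => ?_, fun r => ?_⟩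
  · simp
  · simp only [map_mul, TrivSqZeroExt.snd_mul, hfst, smul_eq_mul, op_smul_eq_smul]
  · simp [hG, g]

/-- Over some differential subfield containing `t`, the second Painlevé equation with parameter
`1 / 2` has a transcendental solution satisfying the Riccati equation `y' = y² + t / 2`. -/
theorem exists_riccati_solution.{u} :
    ∃ (L : Type u) (_ : Field L) (_ : Algebra ℂ L) (D : L → L) (t y : L) (K : Subfield L),
      (∀ N, K ≤ N → IsDifferentialTower D t K N) ∧ Transcendental K y ∧
      D y = y ^ 2 + t / 2 := by
  let R := MvPolynomial (ULift.{u} (Fin 2)) ℂ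
  let L := FractionRing R
  let x : ULift.{u} (Fin 2) → L := fun i => algebraMap R L (MvPolynomial.X i)
  let t := x ⟨0⟩
  let y := x ⟨1⟩
  obtain ⟨D, hadd, hmul, hD⟩ := exists_extend_derivation (L := L)
    (MvPolynomial.mkDerivation (A := L) ℂ fun i : ULift.{u} (Fin 2) => ![1, y ^ 2 + t / 2] i.down)
  have hconst (c : ℂ) : D (algebraMap ℂ L c) = 0 := by
    rw [IsScalarTower.algebraMap_apply ℂ R L, hD, Derivation.map_algebraMap]
  have ht : D t = 1 := by
    exact (hD _).trans (by simp [MvPolynomial.mkDerivation_X])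
  have hy : D y = y ^ 2 + t / 2 := by
    exact (hD _).trans (by simp [MvPolynomial.mkDerivation_X])
  have hind : AlgebraicIndependent ℂ x := by
    have h : x = IsScalarTower.toAlgHom ℂ R L ∘ MvPolynomial.X := rfl
    rw [h, AlgHom.algebraicIndependent_iff (IsScalarTower.toAlgHom ℂ R L)
      (IsFractionRing.injective R L)]
    exact MvPolynomial.algebraicIndependent_X _ _
  let F := IntermediateField.adjoin ℂ {t}
  have htr : Transcendental F y := by
    have h := hind.transcendental_adjoin (s := {⟨0⟩}) (i := ⟨1⟩) (by simp)
    rw [Set.image_singleton] at h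
    exact IntermediateField.transcendental_adjoin_iff.2 h
  have hF : ∀ a ∈ F, D a ∈ F := by
    intro a ha
    induction ha using IntermediateField.adjoin_induction with
    | mem z hz =>
      rw [Set.mem_singleton_iff.1 hz, ht]
      exact one_mem F
    | algebraMap c =>
      rw [hconst]
      exact zero_mem F
    | add a b _ _ ha hb => exact hadd a b ▸ add_mem ha hb
    | mul a b ha' hb' ha hb => exact hmul a b ▸ add_mem (mul_mem ha' hb) (mul_mem hb' ha)
    | inv a ha' ha =>
      rcases eq_or_ne a 0 with rfl | h0
      · rwa [inv_zero]
      · have h1 : D (a * a⁻¹) = 0 := by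
          rw [mul_inv_cancel₀ h0, ← map_one (algebraMap ℂ L), hconst]
        rw [hmul] at h1
        have e : D a⁻¹ = -(a⁻¹ * D a * a⁻¹) := by
          apply mul_left_cancel₀ h0
          linear_combination h1 + a⁻¹ * D a * mul_inv_cancel₀ h0
        rw [e]
        exact neg_mem (mul_mem (mul_mem (inv_mem ha') ha) (inv_mem ha'))
  exact ⟨L, inferInstance, inferInstance, D, t, y, F.toSubfield, fun N hN =>
    ⟨hadd, hmul, hconst, ht, hF, fun c => F.algebraMap_mem c,
      IntermediateField.mem_adjoin_simple_self ℂ t, hN⟩, htr, hy⟩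

theorem exists_dependent_painleveII_solution.{u} (n : ℤ) :
    ∃ (L : Type u) (_ : Field L) (_ : Algebra ℂ L) (D : L → L) (t y : L) (K : Subfield L),
      IsDifferentialTower D t K K ∧
      D (D y) = 2 * y ^ 3 + t * y + algebraMap ℂ L (1 / 2 + n) ∧
      Transcendental K y ∧ ¬ AlgebraicIndependent K ![y, D y] := by
  obtain ⟨L, _, _, D, t, x, K, hT, htr, hx⟩ := exists_riccati_solution.{u}
  set N := K.adjoinAlgebraicClosure x with hN
  have hKN : K ≤ N := K.le_adjoinAlgebraicClosure x
  have hTN := hT N hKN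
  have hxN : x ∈ N := K.self_mem_adjoinAlgebraicClosure x
  have : CharZero L := charZero_of_injective_algebraMap (algebraMap ℂ L).injective
  have ht2K : t / 2 ∈ K := div_mem hTN.t_mem (map_ofNat (algebraMap ℂ L) 2 ▸ hTN.const_mem 2)
  have ht2 : D (t / 2) = 1 / 2 := by
    have h2 : D (t / 2) + D (t / 2) = 1 := by rw [← hTN.map_add, add_halves, hTN.map_t]
    linear_combination h2 / 2
  have hsol : IsPainleveIISolution D t K N (1 / 2) x := by
    refine ⟨hxN, hx ▸ add_mem (pow_mem hxN 2) (hKN ht2K), htr, ?_⟩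
    rw [hx, hTN.map_add, pow_two, hTN.map_mul, ht2, hx, map_div₀, map_one, map_ofNat]
    ring
  have hnat (m : ℕ) : ∃ z, IsPainleveIISolution D t K N (1 / 2 + m) z :=
    hsol.exists_add_natCast hTN (fun k hk => by
      rw [add_right_comm, add_halves] at hk
      exact Nat.cast_add_one_ne_zero (R := ℂ) k (by rw [add_comm, hk])) m
  have hex : ∃ z, IsPainleveIISolution D t K N (1 / 2 + n) z := by
    rcases lt_or_ge n 0 with hn | hn
    · obtain ⟨m, hm⟩ := Int.eq_ofNat_of_zero_le (show 0 ≤ -n - 1 by omega)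
      obtain ⟨z, hz⟩ := hnat m
      refine ⟨-z, ?_⟩
      have hm' : (m : ℂ) = -n - 1 := by exact_mod_cast hm.symm
      rw [show (1 / 2 + n : ℂ) = -(1 / 2 + m) by rw [hm']; ring]
      exact hz.neg hTN
    · obtain ⟨m, rfl⟩ := Int.eq_ofNat_of_zero_le hn
      simpa using hnat m
  obtain ⟨z, hz⟩ := hex
  exact ⟨L, _, _, D, t, z, K, hT K le_rfl, hz.eq, hz.transcendental,
    not_algebraicIndependent_of_isAlgebraic_adjoin (Subfield.mem_adjoinAlgebraicClosure.1 hz.mem)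
      (Subfield.mem_adjoinAlgebraicClosure.1 hz.deriv_mem)⟩

/-- Corollary 3.5: the solution set of `P_II(α) : y'' = 2y³ + ty + α` is strongly minimal
(expressed via the dichotomy: every solution in every differential field extension of `ℂ(t)`
is either algebraic over a given differential subfield `K`, or `y, y'` are algebraically
independent over `K`) if and only if `α ∉ 1/2 + ℤ`. -/
theorem painleveII_strongly_minimal_iff (α : ℂ) :
    (∀ (L : Type*) [Field L] [Algebra ℂ L] (D : L → L),
      (∀ a b : L, D (a + b) = D a + D b) →
      (∀ a b : L, D (a * b) = a * D b + b * D a) →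
      (∀ c : ℂ, D (algebraMap ℂ L c) = 0) →
      ∀ t : L, D t = 1 →
      ∀ K : Subfield L,
        (∀ c : ℂ, algebraMap ℂ L c ∈ K) → t ∈ K → (∀ a ∈ K, D a ∈ K) →
      ∀ y : L, D (D y) = 2 * y ^ 3 + t * y + algebraMap ℂ L α →
        (IsAlgebraic K y ∨ AlgebraicIndependent K ![y, D y]))
    ↔ ¬ ∃ n : ℤ, α = 1 / 2 + (n : ℂ) := by
  constructor
  · rintro h ⟨n, rfl⟩
    obtain ⟨L, _, _, D, t, y, K, hT, hy, htr, hdep⟩ := exists_dependent_painleveII_solution n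
    exact (h L D hT.map_add hT.map_mul hT.map_const t hT.map_t K hT.const_mem hT.t_mem hT.map_mem
      y hy).elim htr hdep
  · intro hα L _ _ D hadd hmul hconst t ht K hC htK hKD y hy
    by_cases ha : IsAlgebraic K y
    · exact Or.inl ha
    · exact Or.inr (painleveII_algebraicIndependent hα
        (fun N hN => ⟨hadd, hmul, hconst, ht, hKD, hC, htK, hN⟩) hy ha)
end
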